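/- arXiv:1705.09748 — 4 statements merged into one kernel-verified Lean document; each statement's English description precedes it below -/
import Mathlib

section
/- There exists a delay-optimal cell partition: there is a cell partition {D_k*}_{k∈L} of D such that J({D_k*}) ≤ J({D_k}) for every cell partition {D_k}_{k∈L} of D. (Paper's Theorem 1: the delay-minimal cell association problem admits an optimal solution.) -/
open MeasureTheory

/-- A cell partition of the region `D`: a family of pairwise disjoint
Lebesgue-measurable subsets of `D` whose union is `D`. -/
def IsCellPartition {ι : Type*} (D : Set (EuclideanSpace ℝ (Fin 2)))
    (P : ι → Set (EuclideanSpace ℝ (Fin 2))) : Prop :=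
  (∀ k, MeasurableSet (P k)) ∧ (∀ k, P k ⊆ D) ∧
    (Pairwise fun l m => Disjoint (P l) (P m)) ∧ (⋃ k, P k) = D

/-- The average network delay of a cell partition `P`. -/
noncomputable def delayJ {ι : Type*} [Fintype ι] (N : ℝ) (W : ι → ℝ)
    (F : ι → EuclideanSpace ℝ (Fin 2) → ℝ) (f : EuclideanSpace ℝ (Fin 2) → ℝ)
    (P : ι → Set (EuclideanSpace ℝ (Fin 2))) : ℝ :=
  ∑ k, (N * (∫ v in P k, f v) / W k) * ∫ v in P k, F k v * f v


theorem hilbert_aux {H : Type*} [NormedAddCommGroup H] [InnerProductSpace ℝ H] [CompleteSpace H]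
    {L : Type*} [Fintype L] (G : Set H) (e : H) (C : ℝ) (K : Set (L → H))
    (hK : K = {u | (∀ k, ∀ g ∈ G, 0 ≤ inner ℝ (u k) g) ∧ ∑ k, u k = e})
    (hC : ∀ u ∈ K, ∀ k, ‖u k‖ ≤ C) (hne : K.Nonempty) (p q : L → H) (c : L → ℝ) :
    ∃ u ∈ K, (∀ u' ∈ K, ∑ k, c k * inner ℝ (u k) (p k) * inner ℝ (u k) (q k)
        ≤ ∑ k, c k * inner ℝ (u' k) (p k) * inner ℝ (u' k) (q k)) ∧
      ∀ δ : L → H, (∀ k, inner ℝ (δ k) (p k) = 0 ∧ inner ℝ (δ k) (q k) = 0) →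
        u + δ ∈ K → u - δ ∈ K → δ = 0 := by
  classical
  let T : (L → H) → (L → WeakDual ℝ H) := fun u k =>
    StrongDual.toWeakDual (InnerProductSpace.toDual ℝ H (u k))
  have hT : ∀ u k x, T u k x = inner ℝ (u k) x := fun u k x => rfl
  have hTs : ∀ v : L → WeakDual ℝ H, ∃ u, T u = v := by
    intro v
    refine ⟨fun k => (InnerProductSpace.toDual ℝ H).symm (WeakDual.toStrongDual (v k)), ?_⟩
    funext k
    simp [T]
  have hTi : ∀ u u', T u = T u' → u = u' := by
    intro u u' h
    funext k
    refine ext_inner_right ℝ fun x => ?_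
    rw [← hT, ← hT, h]
  have hTadd : ∀ u u', T (u + u') = T u + T u' := by
    intro u u'; funext k; simp [T]
  have hTsub : ∀ u u', T (u - u') = T u - T u' := by
    intro u u'; funext k; simp [T]
  have hev : ∀ (k : L) (x : H), Continuous fun v : L → WeakDual ℝ H => v k x := fun k x =>
    (WeakDual.eval_continuous x).comp (continuous_apply k)
  let K1 : Set (L → WeakDual ℝ H) :=
    {v | (∀ k, ∀ g ∈ G, 0 ≤ v k g) ∧ ∀ x, ∑ k, v k x = inner ℝ e x}
  have hK1 : ∀ u, T u ∈ K1 ↔ u ∈ K := by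
    intro u
    rw [hK]
    simp only [K1, Set.mem_ofPred_eq, hT]
    refine and_congr_right fun _ => ?_
    constructor
    · intro h
      refine ext_inner_right ℝ fun x => ?_
      rw [sum_inner]; exact h x
    · intro h x
      rw [← sum_inner, h]
  have hcl : IsClosed K1 := by
    have : K1 = (⋂ k, ⋂ g ∈ G, {v | 0 ≤ v k g}) ∩ ⋂ x, {v | ∑ k, v k x = inner ℝ e x} := by
      ext v; simp [K1]
    rw [this]
    refine IsClosed.inter ?_ ?_
    · exact isClosed_iInter fun k => isClosed_iInter fun g => isClosed_iInter fun _ =>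
        isClosed_le continuous_const (hev k g)
    · exact isClosed_iInter fun x =>
        isClosed_eq (continuous_finsetSum _ fun k _ => hev k x) continuous_const
  have hcomp : IsCompact K1 := by
    refine IsCompact.of_isClosed_subset (isCompact_univ_pi fun k : L =>
      WeakDual.isCompact_closedBall (𝕜 := ℝ) (E := H) 0 C) hcl ?_
    intro v hv
    obtain ⟨u, rfl⟩ := hTs v
    intro k _
    have := hC u ((hK1 u).1 hv) k
    simpa [T] using this
  have hne1 : K1.Nonempty := by
    obtain ⟨u, hu⟩ := hne
    exact ⟨T u, (hK1 u).2 hu⟩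
  obtain ⟨v0, hv0, hmin⟩ := hcomp.exists_isMinOn hne1
    (f := fun v => ∑ k, c k * v k (p k) * v k (q k))
    (continuous_finsetSum _ fun k _ =>
      (continuous_const.mul (hev k _)).mul (hev k _)).continuousOn
  let K2 : Set (L → WeakDual ℝ H) :=
    K1 ∩ ⋂ k, ({v | v k (p k) = v0 k (p k)} ∩ {v | v k (q k) = v0 k (q k)})
  have hcomp2 : IsCompact K2 := hcomp.inter_right <| isClosed_iInter fun k =>
    (isClosed_eq (hev k _) continuous_const).inter (isClosed_eq (hev k _) continuous_const)
  have hm2 : ∀ v, v ∈ K2 ↔ v ∈ K1 ∧ ∀ k, v k (p k) = v0 k (p k) ∧ v k (q k) = v0 k (q k) := by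
    intro v; simp [K2]
  haveI : LocallyConvexSpace ℝ (WeakDual ℝ H) := by
    first
    | infer_instance
    | exact (topDualPairing ℝ H).weakBilin_withSeminorms.toLocallyConvexSpace
  haveI : LocallyConvexSpace ℝ (L → WeakDual ℝ H) := by
    first
    | infer_instance
  obtain ⟨v1, hv1⟩ := hcomp2.extremePoints_nonempty ⟨v0, (hm2 _).2 ⟨hv0, fun k => ⟨rfl, rfl⟩⟩⟩
  rw [mem_extremePoints] at hv1
  obtain ⟨hv1, hext⟩ := hv1
  obtain ⟨u, rfl⟩ := hTs v1
  have hu := (hm2 _).1 hv1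
  refine ⟨u, (hK1 u).1 hu.1, ?_, ?_⟩
  · intro u' hu'
    have h1 := hmin ((hK1 u').2 hu')
    simp only [Set.mem_ofPred_eq, hT] at h1
    refine le_trans (le_of_eq ?_) h1
    refine Finset.sum_congr rfl fun k _ => ?_
    rw [← (hu.2 k).1, ← (hu.2 k).2]; rfl
  · intro δ hδ hp hm
    have h1 : T (u + δ) ∈ K2 := by
      rw [hm2]
      refine ⟨(hK1 _).2 hp, fun k => ?_⟩
      rw [← (hu.2 k).1, ← (hu.2 k).2]
      simp [hT, inner_add_left, hδ k]
    have h2 : T (u - δ) ∈ K2 := by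
      rw [hm2]
      refine ⟨(hK1 _).2 hm, fun k => ?_⟩
      rw [← (hu.2 k).1, ← (hu.2 k).2]
      simp [hT, inner_sub_left, hδ k]
    have h3 := (hext _ h1 _ h2 ⟨1/2, 1/2, by norm_num, by norm_num, by norm_num, by
      rw [hTadd, hTsub]; module⟩).1
    have := hTi _ _ h3
    simpa using this

theorem split_aux {X : Type*} [TopologicalSpace X] [T2Space X] [SecondCountableTopology X]
    [MeasurableSpace X] [BorelSpace X]
    (μ : Measure X) [NullSingletonClass μ] (E : Set X) (hE : MeasurableSet E) (h0 : μ E ≠ 0) (n : ℕ) :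
    ∃ S : Fin n → Set X, (∀ i, MeasurableSet (S i)) ∧ (∀ i, S i ⊆ E) ∧
      (Pairwise fun i j => Disjoint (S i) (S j)) ∧ ∀ i, μ (S i) ≠ 0 := by
  have hinf : (μ.restrict E).support.Infinite := by
    intro hfin
    have h1 : (μ.restrict E) (μ.restrict E).support = 0 := hfin.measure_zero _
    have h2 : (μ.restrict E) (μ.restrict E).supportᶜ = 0 := Measure.measure_compl_support
    apply h0
    rw [← Measure.restrict_apply_univ E, ← Set.union_compl_self (μ.restrict E).support]
    exact measure_union_null h1 h2
  obtain ⟨t, ht, htc⟩ := hinf.exists_subset_card_eq n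
  obtain ⟨U, hU, hd⟩ := t.finite_toSet.t2_separation
  let x : Fin n → X := fun i => (t.equivFin.symm (Fin.cast htc.symm i) : X)
  have hx : ∀ i, x i ∈ t := fun i => (t.equivFin.symm (Fin.cast htc.symm i)).2
  have hxi : Function.Injective x := by
    intro i j h
    have := t.equivFin.symm.injective (Subtype.ext h)
    simpa using this
  refine ⟨fun i => U (x i) ∩ E, fun i => (hU _).2.measurableSet.inter hE,
    fun i => Set.inter_subset_right, ?_, ?_⟩
  · intro i j hij
    exact (hd (hx i) (hx j) (hxi.ne hij)).mono Set.inter_subset_left Set.inter_subset_left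
  · intro i
    have := (Measure.mem_support_iff_forall (x i)).1 (ht (hx i)) (U (x i)) ((hU _).2.mem_nhds (hU _).1)
    rw [Measure.restrict_apply (hU _).2.measurableSet] at this
    exact this.ne'

theorem perturb_aux {X : Type*} [TopologicalSpace X] [T2Space X] [SecondCountableTopology X]
    [MeasurableSpace X] [BorelSpace X]
    (μ : Measure X) [NullSingletonClass μ] (E : Set X) (hE : MeasurableSet E) (h0 : μ E ≠ 0) (n : ℕ)
    (g : Fin n → X → ℝ) (hg : ∀ j, Integrable (g j) μ) (ε : ℝ) (hε : 0 < ε) :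
    ∃ h : X → ℝ, Measurable h ∧ (∀ x, |h x| ≤ ε) ∧ (∀ x, x ∉ E → h x = 0) ∧
      ¬ (h =ᵐ[μ] 0) ∧ ∀ j, ∫ x, h x * g j x ∂μ = 0 := by
  classical
  obtain ⟨S, hSm, hSE, hSd, hS0⟩ := split_aux μ E hE h0 (n + 1)
  let A : (Fin (n+1) → ℝ) →ₗ[ℝ] (Fin n → ℝ) :=
    { toFun := fun c j => ∑ i, c i * ∫ x in S i, g j x ∂μ
      map_add' := by intro a b; funext j; simp [add_mul, Finset.sum_add_distrib]
      map_smul' := by intro a b; funext j; simp [Finset.mul_sum, mul_assoc] }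
  have hk : LinearMap.ker A ≠ ⊥ := LinearMap.ker_ne_bot_of_finrank_lt (by simp)
  obtain ⟨c0, hc0, hcne⟩ := (Submodule.ne_bot_iff _).1 hk
  let c : Fin (n+1) → ℝ := (ε / ‖c0‖) • c0
  have hn : 0 < ‖c0‖ := norm_pos_iff.2 hcne
  have hc : A c = 0 := by
    simp only [c, map_smul]; rw [LinearMap.mem_ker.1 hc0]; simp
  have hcb : ∀ i, |c i| ≤ ε := by
    intro i
    have h1 : ‖c i‖ ≤ ‖c‖ := norm_le_pi_norm c i
    have h2 : ‖c‖ = ε := by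
      simp only [c, norm_smul, Real.norm_eq_abs, abs_of_pos (div_pos hε hn)]
      field_simp
    rw [h2] at h1; exact h1
  obtain ⟨i0, hi0⟩ : ∃ i, c i ≠ 0 := by
    by_contra! hh
    apply hcne
    funext i
    have := hh i
    simp only [c, Pi.smul_apply, smul_eq_mul, mul_eq_zero, div_eq_zero_iff] at this
    rcases this with h | h
    · rcases h with h | h
      · exact absurd h hε.ne'
      · exact absurd h hn.ne'
    · exact h
  let h : X → ℝ := fun x => ∑ i, (S i).indicator (fun _ => c i) x
  have hval : ∀ i x, x ∈ S i → h x = c i := by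
    intro i x hx
    simp only [h]
    rw [Finset.sum_eq_single i]
    · simp [hx]
    · intro j _ hj
      have : x ∉ S j := fun hxj => (Set.disjoint_left.1 (hSd hj)) hxj hx
      simp [this]
    · simp
  have hval0 : ∀ x, (∀ i, x ∉ S i) → h x = 0 := by
    intro x hx
    simp only [h]
    exact Finset.sum_eq_zero fun i _ => by simp [hx i]
  refine ⟨h, ?_, ?_, ?_, ?_, ?_⟩
  · exact Finset.measurable_fun_sum _ fun i _ => measurable_const.indicator (hSm i)
  · intro x
    by_cases hx : ∃ i, x ∈ S i
    · obtain ⟨i, hi⟩ := hx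
      rw [hval i x hi]; exact hcb i
    · push Not at hx
      rw [hval0 x hx]; simpa using hε.le
  · intro x hx
    exact hval0 x fun i hi => hx (hSE i hi)
  · intro hae
    apply hS0 i0
    refine measure_mono_null ?_ (ae_iff.1 hae)
    intro x hx
    simp only [Set.mem_ofPred_eq, hval i0 x hx]
    exact hi0
  · intro j
    have : ∀ x, h x * g j x = ∑ i, (S i).indicator (fun x => c i * g j x) x := by
      intro x
      simp only [h, Finset.sum_mul]
      refine Finset.sum_congr rfl fun i _ => ?_
      by_cases hx : x ∈ S i <;> simp [hx]
    simp_rw [this]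
    rw [integral_finsetSum _ fun i _ => ((hg j).const_mul _).indicator (hSm i)]
    simp_rw [integral_indicator (hSm _), integral_const_mul]
    exact congrFun hc j

theorem partition_aux {X : Type*} [TopologicalSpace X] [T2Space X] [SecondCountableTopology X]
    [MeasurableSpace X] [BorelSpace X]
    (μ : Measure X) [IsFiniteMeasure μ] [NullSingletonClass μ] {L : Type*} [Fintype L] [Nonempty L]
    (p q : L → X → ℝ) (hp : ∀ k, MemLp (p k) 2 μ) (hq : ∀ k, MemLp (q k) 2 μ) (c : L → ℝ) :
    ∃ S : L → Set X, ((∀ k, MeasurableSet (S k)) ∧ (Pairwise fun k l => Disjoint (S k) (S l)) ∧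
      (⋃ k, S k) = Set.univ) ∧
      ∀ P : L → Set X, (∀ k, MeasurableSet (P k)) → (Pairwise fun k l => Disjoint (P k) (P l)) →
      (⋃ k, P k) = Set.univ →
      ∑ k, c k * (∫ x in S k, p k x ∂μ) * (∫ x in S k, q k x ∂μ) ≤
      ∑ k, c k * (∫ x in P k, p k x ∂μ) * (∫ x in P k, q k x ∂μ) := by
  classical
  let e : Lp ℝ 2 μ := indicatorConstLp 2 (MeasurableSet.univ) (measure_ne_top μ _) (1:ℝ)
  have he : ⇑e =ᵐ[μ] fun _ => (1:ℝ) := by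
    filter_upwards [indicatorConstLp_coeFn (p := 2) (hs := MeasurableSet.univ)
      (hμs := measure_ne_top μ Set.univ) (c := (1:ℝ))] with x hx
    simpa [e] using hx
  let ind : Set X → Lp ℝ 2 μ := fun s => if hs : MeasurableSet s then
    indicatorConstLp 2 hs (measure_ne_top μ s) (1:ℝ) else 0
  have hind : ∀ s, MeasurableSet s → ⇑(ind s) =ᵐ[μ] s.indicator (fun _ => (1:ℝ)) := by
    intro s hs
    simp only [ind, dif_pos hs]
    exact indicatorConstLp_coeFn
  have hin : ∀ (u : Lp ℝ 2 μ) s, MeasurableSet s → inner ℝ u (ind s) = ∫ x in s, u x ∂μ := by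
    intro u s hs
    rw [real_inner_comm]
    simp only [ind, dif_pos hs]
    exact L2.inner_indicatorConstLp_one hs (measure_ne_top μ s) u
  have hint : ∀ u : Lp ℝ 2 μ, Integrable u μ := fun u => (Lp.memLp u).integrable (by norm_num)
  let K : Set (L → Lp ℝ 2 μ) :=
    {u | (∀ k, ∀ g ∈ ind '' {s | MeasurableSet s}, 0 ≤ inner ℝ (u k) g) ∧ ∑ k, u k = e}
  have hsum : ∀ u : L → Lp ℝ 2 μ, ∑ k, u k = e ↔ ∀ᵐ x ∂μ, ∑ k, u k x = 1 := by
    intro u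
    have h1 : ⇑(∑ k, u k) =ᵐ[μ] fun x => ∑ k, u k x := by
      filter_upwards [Lp.coeFn_finsetSum (s := Finset.univ) (f := u)] with x hx
      simpa using hx
    constructor
    · intro h
      rw [h] at h1
      filter_upwards [h1, he] with x h2 h3
      rw [← h2, h3]
    · intro h
      apply Lp.ext
      filter_upwards [h1, he, h] with x h2 h3 h4
      rw [h2, h3, h4]
  have hKm : ∀ u, u ∈ K ↔ (∀ k, ∀ᵐ x ∂μ, 0 ≤ u k x) ∧ ∀ᵐ x ∂μ, ∑ k, u k x = 1 := by
    intro u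
    simp only [K, Set.mem_ofPred_eq, hsum]
    refine and_congr_left fun _ => forall_congr' fun k => ?_
    constructor
    · intro h
      refine ae_nonneg_of_forall_setIntegral_nonneg (hint _) fun s hs _ => ?_
      rw [← hin _ _ hs]
      exact h _ ⟨s, hs, rfl⟩
    · rintro h _ ⟨s, hs, rfl⟩
      rw [hin _ _ hs]
      exact integral_nonneg_of_ae (ae_restrict_of_ae h)
  have hK01 : ∀ u ∈ K, ∀ᵐ x ∂μ, (∀ k, 0 ≤ u k x) ∧ ∑ k, u k x = 1 := by
    intro u hu
    rw [hKm] at hu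
    exact (ae_all_iff.2 hu.1).and hu.2
  have hle1 : ∀ u ∈ K, ∀ᵐ x ∂μ, ∀ k, u k x ≤ 1 := by
    intro u hu
    filter_upwards [hK01 u hu] with x hx k
    rw [← hx.2]
    exact Finset.single_le_sum (fun i _ => hx.1 i) (Finset.mem_univ k)
  have hC : ∀ u ∈ K, ∀ k, ‖u k‖ ≤ ‖e‖ := by
    intro u hu k
    apply Lp.norm_le_norm_of_ae_le
    filter_upwards [hK01 u hu, hle1 u hu, he] with x h1 h2 h3
    rw [h3, Real.norm_eq_abs, abs_of_nonneg (h1.1 k)]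
    simpa using h2 k
  have hPK : ∀ P : L → Set X, (∀ k, MeasurableSet (P k)) →
      (Pairwise fun k l => Disjoint (P k) (P l)) → (⋃ k, P k) = Set.univ →
      (fun k => ind (P k)) ∈ K := by
    intro P hm hd hu
    rw [hKm]
    constructor
    · intro k
      filter_upwards [hind _ (hm k)] with x hx
      rw [hx]
      exact Set.indicator_nonneg (fun _ _ => zero_le_one) x
    · filter_upwards [ae_all_iff.2 fun k => hind _ (hm k)] with x hx
      simp only [hx]
      obtain ⟨k, hk⟩ := Set.mem_iUnion.1 (hu ▸ Set.mem_univ x)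
      rw [Finset.sum_eq_single k]
      · simp [hk]
      · intro j _ hj
        have : x ∉ P j := fun hxj => (Set.disjoint_left.1 (hd hj)) hxj hk
        simp [this]
      · simp
  let k0 : L := Classical.arbitrary L
  have hne : K.Nonempty := by
    refine ⟨_, hPK (fun k => if k = k0 then Set.univ else ∅) ?_ ?_ ?_⟩
    · intro k; by_cases h : k = k0 <;> simp [h]
    · intro k l hkl
      by_cases h : k = k0
      · have : l ≠ k0 := fun h' => hkl (h.trans h'.symm)
        simp [this]
      · simp [h]
    · refine Set.eq_univ_of_forall fun x => Set.mem_iUnion.2 ⟨k0, by simp⟩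
  obtain ⟨u, huK, hmin, hext⟩ := hilbert_aux (ind '' {s | MeasurableSet s}) e ‖e‖ K rfl hC hne
    (fun k => (hp k).toLp (p k)) (fun k => (hq k).toLp (q k)) c
  have hmom : ∀ (w : Lp ℝ 2 μ) (s : Set X), MeasurableSet s →
      (w =ᵐ[μ] s.indicator (fun _ => (1:ℝ))) → ∀ (g : X → ℝ) (hg : MemLp g 2 μ),
      inner ℝ w (hg.toLp g) = ∫ x in s, g x ∂μ := by
    intro w s hs hw g hg
    rw [L2.inner_def, ← integral_indicator hs]
    apply integral_congr_ae
    filter_upwards [hw, hg.coeFn_toLp] with x h1 h2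
    rw [h1, h2]
    by_cases hx : x ∈ s <;> simp [hx]
  -- representatives
  have hum : ∀ k, Measurable (u k) := fun k => (Lp.stronglyMeasurable (u k)).measurable
  -- purity
  have hpure : ∀ k l, k ≠ l → ∀ᵐ x ∂μ, ¬ (0 < u k x ∧ 0 < u l x) := by
    intro k l hkl
    by_contra hcon
    have hex : ∃ n : ℕ, μ {x | 1 / ((n:ℝ) + 1) ≤ u k x ∧ 1 / ((n:ℝ) + 1) ≤ u l x} ≠ 0 := by
      by_contra! hall
      apply hcon
      rw [ae_iff]
      refine measure_mono_null ?_ (measure_iUnion_null hall)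
      intro x hx
      simp only [Set.mem_ofPred_eq, not_not] at hx
      obtain ⟨n, hn⟩ := exists_nat_one_div_lt (lt_min hx.1 hx.2)
      rw [Set.mem_iUnion]
      exact ⟨n, (hn.le.trans (min_le_left _ _)), (hn.le.trans (min_le_right _ _))⟩
    obtain ⟨n, hn⟩ := hex
    set ε : ℝ := 1 / ((n:ℝ) + 1) with hεd
    have hε : 0 < ε := by positivity
    let E : Set X := {x | ε ≤ u k x ∧ ε ≤ u l x}
    have hE : MeasurableSet E :=
      (measurableSet_le measurable_const (hum k)).inter (measurableSet_le measurable_const (hum l))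
    obtain ⟨h, hhm, hhb, hhE, hh0, hhi⟩ := perturb_aux μ E hE hn 4 ![p k, q k, p l, q l]
      (by
        intro j
        fin_cases j
        · exact (hp k).integrable (by norm_num)
        · exact (hq k).integrable (by norm_num)
        · exact (hp l).integrable (by norm_num)
        · exact (hq l).integrable (by norm_num)) ε hε
    have hhL : MemLp h 2 μ := MemLp.of_bound hhm.aestronglyMeasurable ε
      (Filter.Eventually.of_forall hhb)
    let η : Lp ℝ 2 μ := hhL.toLp h
    have hη : ⇑η =ᵐ[μ] h := hhL.coeFn_toLp
    have hηi : ∀ (g : X → ℝ) (hg : MemLp g 2 μ), ∫ x, h x * g x ∂μ = 0 →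
        inner ℝ η (hg.toLp g) = 0 := by
      intro g hg h0
      rw [L2.inner_def, ← h0]
      apply integral_congr_ae
      filter_upwards [hη, hg.coeFn_toLp] with x h1 h2
      rw [h1, h2]
      simp [mul_comm]
    let s : L → ℝ := fun j => if j = k then 1 else if j = l then -1 else 0
    have hsk : s k = 1 := by simp [s]
    have hsl : s l = -1 := by simp [s, hkl.symm]
    have hso : ∀ j, j ≠ k → j ≠ l → s j = 0 := by intro j h1 h2; simp [s, h1, h2]
    have hss : ∑ j, s j = 0 := by
      rw [← Finset.add_sum_erase _ _ (Finset.mem_univ k),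
        ← Finset.add_sum_erase _ _ (Finset.mem_erase.2 ⟨hkl.symm, Finset.mem_univ l⟩),
        Finset.sum_eq_zero, hsk, hsl]
      · norm_num
      · intro j hj
        simp only [Finset.mem_erase] at hj
        exact hso j hj.2.1 hj.1
    let δ : L → Lp ℝ 2 μ := fun j => s j • η
    have hδc : ∀ᵐ x ∂μ, ∀ j, δ j x = s j * h x := by
      rw [ae_all_iff]
      intro j
      filter_upwards [Lp.coeFn_smul (s j) η, hη] with x h1 h2
      simp only [δ]
      rw [h1, Pi.smul_apply, h2, smul_eq_mul]
    have hbd : ∀ x j, (∀ i, 0 ≤ u i x) → |s j * h x| ≤ u j x := by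
      intro x j hx
      by_cases hxE : x ∈ E
      · by_cases hjk : j = k
        · rw [hjk, hsk, one_mul]; exact (hhb x).trans hxE.1
        · by_cases hjl : j = l
          · rw [hjl, hsl, neg_one_mul, abs_neg]; exact (hhb x).trans hxE.2
          · rw [hso j hjk hjl]; simpa using hx j
      · rw [hhE x hxE]; simpa using hx j
    have hδ0 : δ = 0 := by
      apply hext
      · intro j
        simp only [δ, real_inner_smul_left]
        by_cases hjk : j = k
        · subst hjk
          rw [hηi _ (hp j) (hhi 0), hηi _ (hq j) (hhi 1)]; simp
        · by_cases hjl : j = l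
          · subst hjl
            rw [hηi _ (hp j) (hhi 2), hηi _ (hq j) (hhi 3)]; simp
          · rw [hso j hjk hjl]; simp
      · rw [hKm]
        have hc : ∀ᵐ x ∂μ, ∀ j, (u + δ) j x = u j x + s j * h x := by
          have := ae_all_iff.2 fun j => Lp.coeFn_add (u j) (δ j)
          filter_upwards [this, hδc] with x h1 h2 j
          rw [← h2]; exact h1 j
        constructor
        · rw [← ae_all_iff]
          filter_upwards [hc, hK01 u huK] with x h1 h2 j
          rw [h1]
          have := neg_le_of_abs_le (hbd x j h2.1)
          linarith
        · filter_upwards [hc, hK01 u huK] with x h1 h2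
          simp only [h1, Finset.sum_add_distrib, h2.2, ← Finset.sum_mul, hss]
          norm_num
      · rw [hKm]
        have hc : ∀ᵐ x ∂μ, ∀ j, (u - δ) j x = u j x - s j * h x := by
          have := ae_all_iff.2 fun j => Lp.coeFn_sub (u j) (δ j)
          filter_upwards [this, hδc] with x h1 h2 j
          rw [← h2]; exact h1 j
        constructor
        · rw [← ae_all_iff]
          filter_upwards [hc, hK01 u huK] with x h1 h2 j
          rw [h1]
          have := le_of_abs_le (hbd x j h2.1)
          linarith
        · filter_upwards [hc, hK01 u huK] with x h1 h2
          simp only [h1, Finset.sum_sub_distrib, h2.2, ← Finset.sum_mul, hss]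
          norm_num
    apply hh0
    have hη0 : η = 0 := by
      have := congrFun hδ0 k
      simpa [δ, hsk] using this
    filter_upwards [hη, Lp.coeFn_zero ℝ 2 μ] with x h1 h2
    rw [← h1, hη0, h2]
  let Gd : Set X := {x | (∀ k, 0 ≤ u k x) ∧ ∑ k, u k x = 1 ∧ ∀ k l, k ≠ l → ¬ (0 < u k x ∧ 0 < u l x)}
  have hGae : ∀ᵐ x ∂μ, x ∈ Gd := by
    have h1 : ∀ᵐ x ∂μ, ∀ k l, k ≠ l → ¬ (0 < u k x ∧ 0 < u l x) := by
      rw [ae_all_iff]; intro k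
      rw [ae_all_iff]; intro l
      by_cases hkl : k = l
      · exact Filter.Eventually.of_forall fun x h => absurd hkl h
      · filter_upwards [hpure k l hkl] with x hx _ using hx
    filter_upwards [h1, hK01 u huK] with x h2 h3
    exact ⟨h3.1, h3.2, h2⟩
  have hGm : MeasurableSet Gd := by
    have : Gd = (⋂ k, {x | 0 ≤ u k x}) ∩ ({x | ∑ k, u k x = 1} ∩
        ⋂ k, ⋂ l, ⋂ (_ : k ≠ l), ({x | 0 < u k x} ∩ {x | 0 < u l x})ᶜ) := by
      ext x
      simp [Gd]
    rw [this]
    refine (MeasurableSet.iInter fun k => measurableSet_le measurable_const (hum k)).inter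
      ((measurableSet_eq_fun (Finset.measurable_fun_sum _ fun k _ => hum k) measurable_const).inter
      (MeasurableSet.iInter fun k => MeasurableSet.iInter fun l => MeasurableSet.iInter fun _ =>
        ((measurableSet_lt measurable_const (hum k)).inter
          (measurableSet_lt measurable_const (hum l))).compl))
  let S : L → Set X := fun k => (Gd ∩ {x | 0 < u k x}) ∪ (if k = k0 then Gdᶜ else ∅)
  have hSm : ∀ k, MeasurableSet (S k) := by
    intro k
    refine (hGm.inter (measurableSet_lt measurable_const (hum k))).union ?_
    split_ifs
    · exact hGm.compl
    · exact MeasurableSet.empty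
  have hSG : ∀ k x, x ∈ Gd → (x ∈ S k ↔ 0 < u k x) := by
    intro k x hx
    by_cases h : k = k0 <;> simp [S, h, hx]
  have hSG' : ∀ k x, x ∉ Gd → (x ∈ S k ↔ k = k0) := by
    intro k x hx
    by_cases h : k = k0 <;> simp [S, h, hx]
  have hpos : ∀ x ∈ Gd, ∃ k, 0 < u k x := by
    intro x hx
    by_contra! hh
    have : ∑ k, u k x ≤ 0 := Finset.sum_nonpos fun k _ => hh k
    rw [hx.2.1] at this
    linarith
  have hSd : Pairwise fun k l => Disjoint (S k) (S l) := by
    intro k l hkl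
    rw [Set.disjoint_left]
    intro x h1 h2
    by_cases hx : x ∈ Gd
    · rw [hSG _ _ hx] at h1 h2
      exact hx.2.2 k l hkl ⟨h1, h2⟩
    · rw [hSG' _ _ hx] at h1 h2
      exact hkl (h1.trans h2.symm)
  have hSu : (⋃ k, S k) = Set.univ := by
    refine Set.eq_univ_of_forall fun x => Set.mem_iUnion.2 ?_
    by_cases hx : x ∈ Gd
    · obtain ⟨k, hk⟩ := hpos x hx
      exact ⟨k, (hSG k x hx).2 hk⟩
    · exact ⟨k0, (hSG' k0 x hx).2 rfl⟩
  have huS : ∀ k, u k =ᵐ[μ] (S k).indicator (fun _ => (1:ℝ)) := by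
    intro k
    filter_upwards [hGae] with x hx
    by_cases hk : 0 < u k x
    · rw [Set.indicator_of_mem ((hSG k x hx).2 hk), ← hx.2.1, eq_comm]
      refine Finset.sum_eq_single k (fun j _ hj => ?_) (by simp)
      exact le_antisymm (not_lt.1 fun h => hx.2.2 j k hj ⟨h, hk⟩) (hx.1 j)
    · rw [Set.indicator_of_notMem (fun h => hk ((hSG k x hx).1 h))]
      exact le_antisymm (not_lt.1 hk) (hx.1 k)
  refine ⟨S, ⟨hSm, hSd, hSu⟩, ?_⟩
  intro P hPm hPd hPu
  have := hmin _ (hPK P hPm hPd hPu)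
  simp only [hmom _ _ (hSm _) (huS _), hmom _ _ (hPm _) (hind _ (hPm _))] at this
  exact this

/-- There exists a delay-optimal cell partition. -/
theorem exists_delay_optimal_cell_partition
    (D : Set (EuclideanSpace ℝ (Fin 2))) (hD : IsCompact D)
    (f : EuclideanSpace ℝ (Fin 2) → ℝ) (hf : Continuous f) (hf0 : ∀ v, 0 ≤ f v)
    (hf1 : (∫ v in D, f v) = 1)
    (L : Type*) [Fintype L] [Nonempty L]
    (W : L → ℝ) (hW : ∀ k, 0 < W k)
    (F : L → EuclideanSpace ℝ (Fin 2) → ℝ)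
    (hF : ∀ k, Continuous (F k)) (hF0 : ∀ k v, 0 ≤ F k v)
    (N : ℝ) (hN : 0 < N) :
    ∃ Dstar : L → Set (EuclideanSpace ℝ (Fin 2)), IsCellPartition D Dstar ∧
      ∀ P : L → Set (EuclideanSpace ℝ (Fin 2)), IsCellPartition D P →
        delayJ N W F f Dstar ≤ delayJ N W F f P := by
  classical
  have hDm : MeasurableSet D := hD.measurableSet
  haveI : IsFiniteMeasure ((volume : Measure (EuclideanSpace ℝ (Fin 2))).restrict D) :=
    ⟨by rw [Measure.restrict_apply_univ]; exact hD.measure_lt_top⟩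
  have hmem : ∀ g : EuclideanSpace ℝ (Fin 2) → ℝ, Continuous g →
      MemLp g 2 ((volume : Measure (EuclideanSpace ℝ (Fin 2))).restrict D) := by
    intro g hg
    obtain ⟨C, hC⟩ := hD.exists_bound_of_continuousOn hg.continuousOn
    exact MemLp.of_bound hg.aestronglyMeasurable C
      ((ae_restrict_iff' hDm).2 (Filter.Eventually.of_forall hC))
  obtain ⟨S, ⟨hSm, hSd, hSu⟩, hS⟩ := partition_aux
    ((volume : Measure (EuclideanSpace ℝ (Fin 2))).restrict D)
    (fun _ : L => f) (fun k v => F k v * f v) (fun _ => hmem f hf)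
    (fun k => hmem _ ((hF k).mul hf)) (fun k => N / W k)
  let k0 : L := Classical.arbitrary L
  refine ⟨fun k => S k ∩ D, ⟨fun k => (hSm k).inter hDm, fun k => Set.inter_subset_right,
    fun k l hkl => (hSd hkl).mono Set.inter_subset_left Set.inter_subset_left, ?_⟩, ?_⟩
  · rw [← Set.iUnion_inter, hSu, Set.univ_inter]
  · rintro P ⟨hPm, hPD, hPd, hPu⟩
    let Q : L → Set (EuclideanSpace ℝ (Fin 2)) := fun k => P k ∪ (if k = k0 then Dᶜ else ∅)
    have hQm : ∀ k, MeasurableSet (Q k) := by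
      intro k
      refine (hPm k).union ?_
      split_ifs
      · exact hDm.compl
      · exact MeasurableSet.empty
    have hQD : ∀ k, Q k ∩ D = P k := by
      intro k
      ext x
      have := @hPD k x
      by_cases h : k = k0
      · simp only [Q, h, if_true, Set.mem_inter_iff, Set.mem_union, Set.mem_compl_iff]
        rw [h] at this
        tauto
      · simp only [Q, h, if_false, Set.mem_inter_iff, Set.union_empty]
        tauto
    have hQ' : ∀ k x, x ∉ D → (x ∈ Q k ↔ k = k0) := by
      intro k x hx
      have := fun h => hx (@hPD k x h)
      by_cases h : k = k0
      · simp [Q, h, hx]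
      · simpa [Q, h] using this
    have hQ : ∀ k x, x ∈ D → (x ∈ Q k ↔ x ∈ P k) := by
      intro k x hx
      rw [← hQD k]; simp [hx]
    have key := hS Q hQm ?_ ?_
    · simp only [Measure.restrict_restrict (hSm _), Measure.restrict_restrict (hQm _), hQD] at key
      have hre : ∀ A : L → Set (EuclideanSpace ℝ (Fin 2)), delayJ N W F f A =
          ∑ k, N / W k * (∫ v in A k, f v) * ∫ v in A k, F k v * f v := by
        intro A
        unfold delayJ
        refine Finset.sum_congr rfl fun k _ => ?_
        ring
      rw [hre, hre]
      exact key
    · intro k l hkl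
      rw [Set.disjoint_left]
      intro x h1 h2
      by_cases hx : x ∈ D
      · rw [hQ _ _ hx] at h1 h2
        exact Set.disjoint_left.1 (hPd hkl) h1 h2
      · rw [hQ' _ _ hx] at h1 h2
        exact hkl (h1.trans h2.symm)
    · refine Set.eq_univ_of_forall fun x => Set.mem_iUnion.2 ?_
      by_cases hx : x ∈ D
      · obtain ⟨k, hk⟩ := Set.mem_iUnion.1 (hPu ▸ hx)
        exact ⟨k, (hQ k x hx).2 hk⟩
      · exact ⟨k0, (hQ' k0 x hx).2 rfl⟩
end

section
/- First-order optimality condition for delay-optimal cell partitions (the inequality established by the ball-swapping variational argument in the proof of the paper's Theorem 2, with linear load functions g_k(z) = Nz/W_k): if the cell partition {D_k*}_{k∈L} minimizes J among all cell partitions of D, and if l, m ∈ L and v₀ is a point of the topological interior of D_l* with f(v₀) > 0, then (1/W_l)·( ∫_{D_l*} F_l(v) f(v) dv + a_l · F_l(v₀) ) ≤ (1/W_m)·( ∫_{D_m*} F_m(v) f(v) dv + a_m · F_m(v₀) ), where a_l = ∫_{D_l*} f and a_m = ∫_{D_m*} f. -/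
open MeasureTheory

/-- First-order optimality condition for delay-optimal cell partitions, with
linear load functions `g_k z = N z / W_k`. -/
theorem delay_optimal_first_order_condition
    (D : Set (EuclideanSpace ℝ (Fin 2))) (hD : IsCompact D)
    (f : EuclideanSpace ℝ (Fin 2) → ℝ) (hf : Continuous f) (hf0 : ∀ v, 0 ≤ f v)
    (hf1 : (∫ v in D, f v) = 1)
    (L : Type*) [Fintype L] [Nonempty L]
    (W : L → ℝ) (hW : ∀ k, 0 < W k)
    (F : L → EuclideanSpace ℝ (Fin 2) → ℝ)
    (hF : ∀ k, Continuous (F k)) (hF0 : ∀ k v, 0 ≤ F k v)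
    (N : ℝ) (hN : 0 < N)
    (Dstar : L → Set (EuclideanSpace ℝ (Fin 2)))
    (hpart : IsCellPartition D Dstar)
    (hopt : ∀ P : L → Set (EuclideanSpace ℝ (Fin 2)), IsCellPartition D P →
      delayJ N W F f Dstar ≤ delayJ N W F f P)
    (l m : L) (v₀ : EuclideanSpace ℝ (Fin 2))
    (hv₀ : v₀ ∈ interior (Dstar l)) (hfv₀ : 0 < f v₀) :
    (1 / W l) * ((∫ v in Dstar l, F l v * f v) + (∫ v in Dstar l, f v) * F l v₀)
      ≤ (1 / W m) * ((∫ v in Dstar m, F m v * f v) + (∫ v in Dstar m, f v) * F m v₀) := by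
  classical
  obtain ⟨hmeas, hsub, hdisj, hun⟩ := hpart
  by_cases hlm : l = m
  · subst hlm; exact le_refl _
  have hml : m ≠ l := fun h => hlm h.symm
  have key : ∀ ε : ℝ, 0 < ε →
      (1 / W l) * ((∫ v in Dstar l, F l v * f v) + (∫ v in Dstar l, f v) * (F l v₀ - ε)
        - (F l v₀ + ε) * ε)
      ≤ (1 / W m) * ((∫ v in Dstar m, F m v * f v) + (∫ v in Dstar m, f v) * (F m v₀ + ε)
        + (F m v₀ + ε) * ε) := by
    intro ε hε
    have h1 : ∀ᶠ v in nhds v₀, v ∈ Dstar l ∧ 0 < f v ∧ f v < f v₀ + 1 ∧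
        F l v₀ - ε < F l v ∧ F l v < F l v₀ + ε ∧ F m v < F m v₀ + ε := by
      have a1 : ∀ᶠ v in nhds v₀, v ∈ Dstar l := mem_interior_iff_mem_nhds.mp hv₀
      have a2 := (hf.tendsto v₀).eventually_const_lt hfv₀
      have a3 := (hf.tendsto v₀).eventually_lt_const (show f v₀ < f v₀ + 1 by linarith)
      have a4 := ((hF l).tendsto v₀).eventually_const_lt (show F l v₀ - ε < F l v₀ by linarith)
      have a5 := ((hF l).tendsto v₀).eventually_lt_const (show F l v₀ < F l v₀ + ε by linarith)
      have a6 := ((hF m).tendsto v₀).eventually_lt_const (show F m v₀ < F m v₀ + ε by linarith)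
      filter_upwards [a1, a2, a3, a4, a5, a6] with v b1 b2 b3 b4 b5 b6
      exact ⟨b1, b2, b3, b4, b5, b6⟩
    obtain ⟨δ, hδ, hball⟩ := Metric.eventually_nhds_iff_ball.mp h1
    have h2 : ∀ᶠ r : ℝ in nhds 0, (f v₀ + 1) * (r ^ 2 * Real.pi) < ε := by
      have hc : Continuous fun r : ℝ => (f v₀ + 1) * (r ^ 2 * Real.pi) := by fun_prop
      exact (hc.tendsto 0).eventually_lt_const (by simpa using hε)
    obtain ⟨δ', hδ', hr'⟩ := Metric.eventually_nhds_iff_ball.mp h2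
    obtain ⟨r, hr0, hrlt⟩ := exists_between (lt_min hδ hδ')
    have hrε := hr' r (by
      rw [Metric.mem_ball, Real.dist_eq, sub_zero, abs_of_pos hr0]
      exact lt_of_lt_of_le hrlt (min_le_right _ _))
    have hB : ∀ v ∈ Metric.ball v₀ r, v ∈ Dstar l ∧ 0 < f v ∧ f v < f v₀ + 1 ∧
        F l v₀ - ε < F l v ∧ F l v < F l v₀ + ε ∧ F m v < F m v₀ + ε := fun v hv =>
      hball v (Metric.ball_subset_ball (hrlt.le.trans (min_le_left _ _)) hv)
    set B := Metric.ball v₀ r with hBdef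
    have hBm : MeasurableSet B := measurableSet_ball
    have hBl : B ⊆ Dstar l := fun v hv => (hB v hv).1
    have hBD : B ⊆ D := hBl.trans (hsub l)
    have hBdm : Disjoint (Dstar m) B := (hdisj hml).mono_right hBl
    have hfi : IntegrableOn f D := hf.continuousOn.integrableOn_compact hD
    have hFi : ∀ k, IntegrableOn (fun v => F k v * f v) D := fun k =>
      ((hF k).mul hf).continuousOn.integrableOn_compact hD
    have hBvol : volume.real B = r ^ 2 * Real.pi := by
      rw [hBdef, Measure.real, EuclideanSpace.volume_ball_fin_two]
      simp [ENNReal.toReal_ofReal hr0.le, Real.pi_pos.le]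
    have hBfin : volume B ≠ ⊤ := measure_ball_lt_top.ne
    -- the integrals over the ball
    have he0 : 0 < ∫ v in B, f v := by
      rw [setIntegral_pos_iff_support_of_nonneg_ae
        (Filter.Eventually.of_forall hf0) (hfi.mono_set hBD)]
      have : Function.support f ∩ B = B := by
        apply Set.inter_eq_right.mpr
        intro v hv
        exact (hB v hv).2.1.ne'
      rw [this]
      exact Metric.measure_ball_pos _ _ hr0
    have heε : (∫ v in B, f v) ≤ ε := by
      have : (∫ v in B, f v) ≤ ∫ v in B, (f v₀ + 1) :=
        setIntegral_mono_on (hfi.mono_set hBD) (integrableOn_const hBfin) hBm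
          (fun v hv => (hB v hv).2.2.1.le)
      rw [setIntegral_const, hBvol, smul_eq_mul] at this
      linarith
    have hp1 : (F l v₀ - ε) * (∫ v in B, f v) ≤ ∫ v in B, F l v * f v := by
      rw [← integral_const_mul]
      exact setIntegral_mono_on ((hfi.mono_set hBD).const_mul _) ((hFi l).mono_set hBD) hBm
        (fun v hv => mul_le_mul_of_nonneg_right (hB v hv).2.2.2.1.le (hf0 v))
    have hp2 : (∫ v in B, F l v * f v) ≤ (F l v₀ + ε) * (∫ v in B, f v) := by
      rw [← integral_const_mul]
      exact setIntegral_mono_on ((hFi l).mono_set hBD) ((hfi.mono_set hBD).const_mul _) hBm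
        (fun v hv => mul_le_mul_of_nonneg_right (hB v hv).2.2.2.2.1.le (hf0 v))
    have hq : (∫ v in B, F m v * f v) ≤ (F m v₀ + ε) * (∫ v in B, f v) := by
      rw [← integral_const_mul]
      exact setIntegral_mono_on ((hFi m).mono_set hBD) ((hfi.mono_set hBD).const_mul _) hBm
        (fun v hv => mul_le_mul_of_nonneg_right (hB v hv).2.2.2.2.2.le (hf0 v))
    -- the swapped partition
    let P : L → Set (EuclideanSpace ℝ (Fin 2)) := fun k =>
      if k = l then Dstar l \ B else if k = m then Dstar m ∪ B else Dstar k
    have hPl : P l = Dstar l \ B := by simp [P]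
    have hPm : P m = Dstar m ∪ B := by simp [P, hml]
    have hPk : ∀ k, k ≠ l → k ≠ m → P k = Dstar k := fun k h1 h2 => by simp [P, h1, h2]
    have hmemP : ∀ k v, v ∈ P k ↔ (v ∈ B ∧ k = m) ∨ (v ∉ B ∧ v ∈ Dstar k) := by
      intro k v
      by_cases hkl : k = l
      · subst hkl; rw [hPl]; simp [hlm]; tauto
      by_cases hkm : k = m
      · subst hkm; rw [hPm]; simp; tauto
      rw [hPk k hkl hkm]
      have : v ∈ Dstar k → v ∉ B := fun h hb =>
        Set.disjoint_left.mp (hdisj hkl) h (hBl hb)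
      tauto
    have hP : IsCellPartition D P := by
      refine ⟨fun k => ?_, fun k v hv => ?_, fun i j hij => ?_, ?_⟩
      · by_cases hkl : k = l
        · subst hkl; rw [hPl]; exact (hmeas _).diff hBm
        by_cases hkm : k = m
        · subst hkm; rw [hPm]; exact (hmeas _).union hBm
        rw [hPk k hkl hkm]; exact hmeas k
      · rcases (hmemP k v).mp hv with h | h
        · exact hBD h.1
        · exact hsub k h.2
      · refine Set.disjoint_left.mpr fun v hi hj => ?_
        rcases (hmemP i v).mp hi with h | h <;> rcases (hmemP j v).mp hj with h' | h'
        · exact hij (h.2.trans h'.2.symm)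
        · exact h'.1 h.1
        · exact h.1 h'.1
        · exact Set.disjoint_left.mp (hdisj hij) h.2 h'.2
      · ext v
        rw [Set.mem_iUnion]
        constructor
        · rintro ⟨k, hk⟩
          rcases (hmemP k v).mp hk with h | h
          · exact hBD h.1
          · exact hsub k h.2
        · intro hv
          by_cases hb : v ∈ B
          · exact ⟨m, (hmemP m v).mpr (Or.inl ⟨hb, rfl⟩)⟩
          · rw [← hun, Set.mem_iUnion] at hv
            obtain ⟨k, hk⟩ := hv
            exact ⟨k, (hmemP k v).mpr (Or.inr ⟨hb, hk⟩)⟩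
    have hJ := hopt P hP
    have hdiff : delayJ N W F f P - delayJ N W F f Dstar =
        ((N * (∫ v in P l, f v) / W l) * (∫ v in P l, F l v * f v)
          - (N * (∫ v in Dstar l, f v) / W l) * ∫ v in Dstar l, F l v * f v)
        + ((N * (∫ v in P m, f v) / W m) * (∫ v in P m, F m v * f v)
          - (N * (∫ v in Dstar m, f v) / W m) * ∫ v in Dstar m, F m v * f v) := by
      unfold delayJ
      rw [← Finset.sum_sub_distrib]
      refine Finset.sum_eq_add l m hlm ?_ (by simp) (by simp)
      rintro k - ⟨h1, h2⟩
      rw [hPk k h1 h2, sub_self]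
    rw [hPl, hPm, setIntegral_sdiff hBm (hfi.mono_set (hsub l)) hBl,
      setIntegral_sdiff hBm ((hFi l).mono_set (hsub l)) hBl,
      setIntegral_union hBdm hBm (hfi.mono_set (hsub m)) (hfi.mono_set hBD),
      setIntegral_union hBdm hBm ((hFi m).mono_set (hsub m)) ((hFi m).mono_set hBD)] at hdiff
    have hal : 0 ≤ ∫ v in Dstar l, f v := integral_nonneg hf0
    have ham : 0 ≤ ∫ v in Dstar m, f v := integral_nonneg hf0
    have hFl := hF0 l v₀
    have hFm := hF0 m v₀
    have hWl := hW l
    have hWm := hW m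
    generalize (∫ v in B, f v) = e at *
    generalize (∫ v in B, F l v * f v) = p at *
    generalize (∫ v in B, F m v * f v) = q at *
    generalize (∫ v in Dstar l, f v) = al at *
    generalize (∫ v in Dstar m, f v) = am at *
    generalize (∫ v in Dstar l, F l v * f v) = Il at *
    generalize (∫ v in Dstar m, F m v * f v) = Im at *
    have h3 : 0 ≤ N * ((1 / W m) * (e * Im + am * q + e * q)
        - (1 / W l) * (e * Il + al * p - e * p)) := by
      have : N * ((1 / W m) * (e * Im + am * q + e * q)
        - (1 / W l) * (e * Il + al * p - e * p)) =
          delayJ N W F f P - delayJ N W F f Dstar := by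
        rw [hdiff]; ring
      linarith
    have h4 := nonneg_of_mul_nonneg_right h3 hN
    have h5 : e * (Il + al * (F l v₀ - ε) - (F l v₀ + ε) * ε) ≤ e * Il + al * p - e * p := by
      have b1 := mul_le_mul_of_nonneg_left hp1 hal
      have b2 := mul_le_mul_of_nonneg_left hp2 he0.le
      have b3 := mul_le_mul_of_nonneg_left heε (show 0 ≤ e * (F l v₀ + ε) by positivity)
      nlinarith
    have h6 : e * Im + am * q + e * q ≤ e * (Im + am * (F m v₀ + ε) + (F m v₀ + ε) * ε) := by
      have b1 := mul_le_mul_of_nonneg_left hq ham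
      have b2 := mul_le_mul_of_nonneg_left hq he0.le
      have b3 := mul_le_mul_of_nonneg_left heε (show 0 ≤ e * (F m v₀ + ε) by positivity)
      nlinarith
    have h7 := mul_le_mul_of_nonneg_left h5 (show 0 ≤ 1 / W l by positivity)
    have h8 := mul_le_mul_of_nonneg_left h6 (show 0 ≤ 1 / W m by positivity)
    refine le_of_mul_le_mul_left ?_ he0
    rw [mul_left_comm e, mul_left_comm e]
    linarith
  generalize (∫ v in Dstar l, f v) = al at *
  generalize (∫ v in Dstar m, f v) = am at *
  generalize (∫ v in Dstar l, F l v * f v) = Il at *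
  generalize (∫ v in Dstar m, F m v * f v) = Im at *
  have c1 : Continuous fun ε : ℝ =>
    (1 / W l) * (Il + al * (F l v₀ - ε) - (F l v₀ + ε) * ε) := by fun_prop
  have c2 : Continuous fun ε : ℝ =>
    (1 / W m) * (Im + am * (F m v₀ + ε) + (F m v₀ + ε) * ε) := by fun_prop
  have t1 := (c1.tendsto 0).mono_left (nhdsWithin_le_nhds (s := Set.Ioi 0))
  have t2 := (c2.tendsto 0).mono_left (nhdsWithin_le_nhds (s := Set.Ioi 0))
  have := le_of_tendsto_of_tendsto t1 t2 (by
    filter_upwards [self_mem_nhdsWithin] with ε hε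
    exact key ε hε)
  simpa using this
end

section
/- First-order optimality condition with general differentiable load functions (the intermediate inequality in the proof of the paper's Theorem 2 before specializing g_k): suppose the cell partition {D_k*}_{k∈L} minimizes J_g among all cell partitions of D, let l, m ∈ L, let v₀ be a point of the topological interior of D_l* with f(v₀) > 0, and suppose g_l is differentiable at a_l and g_m is differentiable at a_m (where a_k = ∫_{D_k*} f). Then g_l'(a_l)·∫_{D_l*} F_l(v) f(v) dv + g_l(a_l)·F_l(v₀) ≤ g_m'(a_m)·∫_{D_m*} F_m(v) f(v) dv + g_m(a_m)·F_m(v₀). -/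
open MeasureTheory

/-- The cost of a cell partition `P` with general load penalty functions `g_k`. -/
noncomputable def costJg {ι : Type*} [Fintype ι] (g : ι → ℝ → ℝ)
    (F : ι → EuclideanSpace ℝ (Fin 2) → ℝ) (f : EuclideanSpace ℝ (Fin 2) → ℝ)
    (P : ι → Set (EuclideanSpace ℝ (Fin 2))) : ℝ :=
  ∑ k, g k (∫ v in P k, f v) * ∫ v in P k, F k v * f v

open Filter Topology in
theorem aux_avg (h : EuclideanSpace ℝ (Fin 2) → ℝ) (hh : Continuous h)
    (v₀ : EuclideanSpace ℝ (Fin 2)) :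
    Tendsto (fun r : ℝ => (∫ v in Metric.ball v₀ r, h v) / volume.real (Metric.ball v₀ r))
      (𝓝[>] 0) (𝓝 (h v₀)) := by
  have hs : Tendsto (fun r : ℝ => Metric.ball v₀ r) (𝓝[>] 0) (𝓝 v₀).smallSets := by
    rw [Metric.nhds_basis_ball.smallSets.tendsto_right_iff]
    intro ε hε
    filter_upwards [Ioo_mem_nhdsGT hε] with r hr
    exact Metric.ball_subset_ball hr.2.le
  have h1 := (hh.continuousAt (x := v₀)).integral_sub_linear_isLittleO_ae
    (μ := volume) hh.stronglyMeasurable.stronglyMeasurableAtFilter hs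
  have h2 := h1.tendsto_div_nhds_zero.add_const (h v₀)
  rw [zero_add] at h2
  refine h2.congr' ?_
  filter_upwards [self_mem_nhdsWithin] with r hr
  have : 0 < volume.real (Metric.ball v₀ r) :=
    ENNReal.toReal_pos (Metric.measure_ball_pos _ _ hr).ne' measure_ball_lt_top.ne
  simp only [smul_eq_mul]
  field_simp
  ring

open Filter Topology in
theorem aux_vol (v₀ : EuclideanSpace ℝ (Fin 2)) :
    Tendsto (fun r : ℝ => volume.real (Metric.ball v₀ r)) (𝓝[>] 0) (𝓝 0) := by
  have h : Tendsto (fun r : ℝ => r ^ 2 * volume.real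
      (Metric.ball (0 : EuclideanSpace ℝ (Fin 2)) 1)) (𝓝[>] 0) (𝓝 0) := by
    have : Continuous (fun r : ℝ => r ^ 2 * volume.real
      (Metric.ball (0 : EuclideanSpace ℝ (Fin 2)) 1)) := by fun_prop
    have := (this.tendsto 0).mono_left (nhdsWithin_le_nhds (s := Set.Ioi 0))
    simpa using this
  refine h.congr' ?_
  filter_upwards [self_mem_nhdsWithin] with r hr
  rw [measureReal_def, measureReal_def, Measure.addHaar_ball_of_pos _ _ hr, ENNReal.toReal_mul,
    ENNReal.toReal_ofReal (pow_nonneg (le_of_lt hr) _)]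
  simp

open Filter Topology in
theorem aux_exchange {L : Type*} [Fintype L] (D : Set (EuclideanSpace ℝ (Fin 2)))
    (hD : IsCompact D)
    (f : EuclideanSpace ℝ (Fin 2) → ℝ) (hf : Continuous f)
    (F : L → EuclideanSpace ℝ (Fin 2) → ℝ)
    (hF : ∀ k, Continuous (F k))
    (g : L → ℝ → ℝ)
    (P : L → Set (EuclideanSpace ℝ (Fin 2)))
    (hpart : IsCellPartition D P)
    (hopt : ∀ Q : L → Set (EuclideanSpace ℝ (Fin 2)), IsCellPartition D Q →
      costJg g F f P ≤ costJg g F f Q)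
    (l m : L) (hlm : l ≠ m) (B : Set (EuclideanSpace ℝ (Fin 2))) (hB : MeasurableSet B)
    (hBl : B ⊆ P l) :
    g l (∫ v in P l, f v) * (∫ v in P l, F l v * f v)
      + g m (∫ v in P m, f v) * (∫ v in P m, F m v * f v)
    ≤ g l ((∫ v in P l, f v) - ∫ v in B, f v)
        * ((∫ v in P l, F l v * f v) - ∫ v in B, F l v * f v)
      + g m ((∫ v in P m, f v) + ∫ v in B, f v)
        * ((∫ v in P m, F m v * f v) + ∫ v in B, F m v * f v) := by
  classical
  obtain ⟨hm, hsub, hdis, hun⟩ := hpart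
  have hint : ∀ (h : EuclideanSpace ℝ (Fin 2) → ℝ), Continuous h →
      ∀ k, IntegrableOn h (P k) := fun h hh k =>
    (hh.continuousOn.integrableOn_compact hD).mono_set (hsub k)
  have hintB : ∀ (h : EuclideanSpace ℝ (Fin 2) → ℝ), Continuous h → IntegrableOn h B :=
    fun h hh => (hint h hh l).mono_set hBl
  have hFf : ∀ k, Continuous (fun v => F k v * f v) := fun k => (hF k).mul hf
  have hBd : ∀ k, k ≠ l → Disjoint (P k) B := fun k hk => (hdis hk).mono_right hBl
  let Q : L → Set (EuclideanSpace ℝ (Fin 2)) := fun k => if k = m then P m ∪ B else P k \ B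
  have hQm : Q m = P m ∪ B := by simp [Q]
  have hQl : Q l = P l \ B := by simp [Q, hlm]
  have hQ : ∀ k, k ≠ l → k ≠ m → Q k = P k := by
    intro k hk1 hk2
    simp only [Q, hk2, if_false]
    exact (hBd k hk1).sdiff_eq_left
  have hQp : IsCellPartition D Q := by
    refine ⟨?_, ?_, ?_, ?_⟩
    · intro k
      by_cases hk : k = m
      · subst hk; rw [hQm]; exact (hm _).union hB
      · simp only [Q, hk, if_false]; exact (hm _).diff hB
    · intro k
      by_cases hk : k = m
      · subst hk; rw [hQm]; exact Set.union_subset (hsub _) (hBl.trans (hsub _))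
      · simp only [Q, hk, if_false]; exact Set.sdiff_subset.trans (hsub _)
    · have key : ∀ k, k ≠ m → Disjoint (P k \ B) (P m ∪ B) := fun k hk =>
        Set.disjoint_union_right.2
          ⟨(hdis hk).mono_left Set.sdiff_subset, Set.disjoint_sdiff_left⟩
      intro i j hij
      simp only [Q]
      split_ifs with h1 h2 h2
      · exact absurd (h1.trans h2.symm) hij
      · exact (key j h2).symm
      · exact key i h1
      · exact (hdis hij).mono Set.sdiff_subset Set.sdiff_subset
    · rw [← hun]
      ext x
      simp only [Set.mem_iUnion]
      constructor
      · rintro ⟨k, hk⟩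
        by_cases hkm : k = m
        · subst hkm
          rw [hQm] at hk
          rcases hk with hk | hk
          · exact ⟨_, hk⟩
          · exact ⟨l, hBl hk⟩
        · simp only [Q, hkm, if_false] at hk
          exact ⟨k, hk.1⟩
      · rintro ⟨k, hk⟩
        by_cases hx : x ∈ B
        · exact ⟨m, by rw [hQm]; exact Or.inr hx⟩
        · by_cases hkm : k = m
          · subst hkm
            exact ⟨k, by rw [hQm]; exact Or.inl hk⟩
          · exact ⟨k, by simp only [Q, hkm, if_false]; exact ⟨hk, hx⟩⟩
  have h0 := hopt Q hQp
  have h1 : costJg g F f Q - costJg g F f P =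
      (g l (∫ v in Q l, f v) * (∫ v in Q l, F l v * f v)
        - g l (∫ v in P l, f v) * (∫ v in P l, F l v * f v))
      + (g m (∫ v in Q m, f v) * (∫ v in Q m, F m v * f v)
        - g m (∫ v in P m, f v) * (∫ v in P m, F m v * f v)) := by
    unfold costJg
    rw [← Finset.sum_sub_distrib]
    refine Finset.sum_eq_add l m hlm ?_ (by simp) (by simp)
    rintro k - ⟨hk1, hk2⟩
    rw [hQ k hk1 hk2, sub_self]
  have hd : ∀ (h : EuclideanSpace ℝ (Fin 2) → ℝ), Continuous h →
      ∫ v in Q l, h v = (∫ v in P l, h v) - ∫ v in B, h v := fun h hh => by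
    rw [hQl]; exact setIntegral_sdiff₀ hB.nullMeasurableSet (hint h hh l) hBl
  have hu : ∀ (h : EuclideanSpace ℝ (Fin 2) → ℝ), Continuous h →
      ∫ v in Q m, h v = (∫ v in P m, h v) + ∫ v in B, h v := fun h hh => by
    rw [hQm]; exact setIntegral_union (hBd m hlm.symm) hB (hint h hh m) (hintB h hh)
  rw [hd f hf, hd _ (hFf l), hu f hf, hu _ (hFf m)] at h1
  linarith

open Filter Topology in
/-- First-order optimality condition for optimal cell partitions with general
differentiable load functions `g_k`. -/
theorem optimal_first_order_condition_general_load
    (D : Set (EuclideanSpace ℝ (Fin 2))) (hD : IsCompact D)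
    (f : EuclideanSpace ℝ (Fin 2) → ℝ) (hf : Continuous f) (hf0 : ∀ v, 0 ≤ f v)
    (hf1 : (∫ v in D, f v) = 1)
    (L : Type*) [Fintype L] [Nonempty L]
    (F : L → EuclideanSpace ℝ (Fin 2) → ℝ)
    (hF : ∀ k, Continuous (F k)) (hF0 : ∀ k v, 0 ≤ F k v)
    (g : L → ℝ → ℝ) (hg : ∀ k, Continuous (g k))
    (Dstar : L → Set (EuclideanSpace ℝ (Fin 2)))
    (hpart : IsCellPartition D Dstar)
    (hopt : ∀ P : L → Set (EuclideanSpace ℝ (Fin 2)), IsCellPartition D P →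
      costJg g F f Dstar ≤ costJg g F f P)
    (l m : L) (v₀ : EuclideanSpace ℝ (Fin 2))
    (hv₀ : v₀ ∈ interior (Dstar l)) (hfv₀ : 0 < f v₀)
    (hgl : DifferentiableAt ℝ (g l) (∫ v in Dstar l, f v))
    (hgm : DifferentiableAt ℝ (g m) (∫ v in Dstar m, f v)) :
    deriv (g l) (∫ v in Dstar l, f v) * (∫ v in Dstar l, F l v * f v)
        + g l (∫ v in Dstar l, f v) * F l v₀
      ≤ deriv (g m) (∫ v in Dstar m, f v) * (∫ v in Dstar m, F m v * f v)
        + g m (∫ v in Dstar m, f v) * F m v₀ := by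
  rcases eq_or_ne l m with rfl | hlm
  · exact le_rfl
  have ht := aux_vol v₀
  have hs := aux_avg f hf v₀
  have hc : ∀ k, Tendsto (fun r : ℝ => (∫ v in Metric.ball v₀ r, F k v * f v)
      / (∫ v in Metric.ball v₀ r, f v)) (𝓝[>] 0) (𝓝 (F k v₀)) := by
    intro k
    have h1 := (aux_avg (fun v => F k v * f v) ((hF k).mul hf) v₀).div hs hfv₀.ne'
    rw [mul_div_cancel_right₀ _ hfv₀.ne'] at h1
    refine h1.congr' ?_
    filter_upwards [self_mem_nhdsWithin] with r hr
    have : 0 < volume.real (Metric.ball v₀ r) :=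
      ENNReal.toReal_pos (Metric.measure_ball_pos _ _ hr).ne' measure_ball_lt_top.ne
    simp only [Pi.div_apply]
    exact div_div_div_cancel_right₀ this.ne' _ _
  have hspos : ∀ᶠ r : ℝ in 𝓝[>] 0, 0 < ∫ v in Metric.ball v₀ r, f v := by
    filter_upwards [hs.eventually (lt_mem_nhds hfv₀), self_mem_nhdsWithin] with r h1 hr
    have : 0 < volume.real (Metric.ball v₀ r) :=
      ENNReal.toReal_pos (Metric.measure_ball_pos _ _ hr).ne' measure_ball_lt_top.ne
    exact (div_pos_iff_of_pos_right this).1 h1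
  have hs0 : Tendsto (fun r : ℝ => ∫ v in Metric.ball v₀ r, f v) (𝓝[>] 0) (𝓝 0) := by
    have h1 := hs.mul ht
    rw [mul_zero] at h1
    refine h1.congr' ?_
    filter_upwards [self_mem_nhdsWithin] with r hr
    have : 0 < volume.real (Metric.ball v₀ r) :=
      ENNReal.toReal_pos (Metric.measure_ball_pos _ _ hr).ne' measure_ball_lt_top.ne
    exact div_mul_cancel₀ _ this.ne'
  have hsP : Tendsto (fun r : ℝ => ∫ v in Metric.ball v₀ r, f v) (𝓝[>] 0) (𝓝[≠] 0) :=
    tendsto_nhdsWithin_iff.2 ⟨hs0, hspos.mono fun r hr => hr.ne'⟩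
  have hsN : Tendsto (fun r : ℝ => -∫ v in Metric.ball v₀ r, f v) (𝓝[>] 0) (𝓝[≠] 0) :=
    tendsto_nhdsWithin_iff.2 ⟨by simpa using hs0.neg,
      hspos.mono fun r hr => neg_ne_zero.2 hr.ne'⟩
  have hdl := hgl.hasDerivAt.tendsto_slope_zero.comp hsN
  have hdm := hgm.hasDerivAt.tendsto_slope_zero.comp hsP
  have hcl : Tendsto (fun r : ℝ => g l ((∫ v in Dstar l, f v) - ∫ v in Metric.ball v₀ r, f v))
      (𝓝[>] 0) (𝓝 (g l (∫ v in Dstar l, f v))) := by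
    have := ((hg l).tendsto _).comp (hs0.const_sub (∫ v in Dstar l, f v))
    rwa [sub_zero] at this
  have hcm : Tendsto (fun r : ℝ => g m ((∫ v in Dstar m, f v) + ∫ v in Metric.ball v₀ r, f v))
      (𝓝[>] 0) (𝓝 (g m (∫ v in Dstar m, f v))) := by
    have := ((hg m).tendsto _).comp (hs0.const_add (∫ v in Dstar m, f v))
    rwa [add_zero] at this
  refine le_of_tendsto_of_tendsto
    ((hdl.mul_const (∫ v in Dstar l, F l v * f v)).add (hcl.mul (hc l)))
    ((hdm.mul_const (∫ v in Dstar m, F m v * f v)).add (hcm.mul (hc m))) ?_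
  obtain ⟨ε, hε, hεl⟩ := Metric.isOpen_iff.1 isOpen_interior v₀ hv₀
  filter_upwards [hspos, Ioo_mem_nhdsGT hε] with r hr hrε
  have hBl : Metric.ball v₀ r ⊆ Dstar l :=
    ((Metric.ball_subset_ball hrε.2.le).trans hεl).trans interior_subset
  have key := aux_exchange D hD f hf F hF g Dstar hpart hopt l m hlm _ measurableSet_ball hBl
  simp only [Function.comp_apply, smul_eq_mul, ← sub_eq_add_neg]
  generalize (∫ v in Metric.ball v₀ r, f v) = s at *
  generalize (∫ v in Metric.ball v₀ r, F l v * f v) = cl at *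
  generalize (∫ v in Metric.ball v₀ r, F m v * f v) = cm at *
  rw [← sub_nonneg] at key ⊢
  have := div_nonneg key hr.le
  convert this using 1
  field_simp
  ring
end

section
/- Semi-discrete optimal transport existence with prescribed cell masses (the specialization of the paper's Lemma 1, from Crippa et al., that the proof of Theorem 1 uses): there exists a measurable map T : Ω → S with μ(T⁻¹({s_k})) = a_k for every k ∈ {1,…,n}, such that ∫_Ω c(x, T(x)) dμ(x) ≤ ∫_Ω c(x, T'(x)) dμ(x) for every measurable map T' : Ω → S satisfying μ(T'⁻¹({s_k})) = a_k for all k. Equivalently, among all measurable partitions {D_k}_{k=1}^n of Ω with μ(D_k) = a_k, there is one minimizing ∑_{k=1}^n ∫_{D_k} c(x, s_k) dμ(x). -/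
open MeasureTheory

set_option linter.unusedSectionVars false
set_option linter.unusedVariables false

namespace SDOT

instance lcWeak {H : Type*} [NormedAddCommGroup H] [NormedSpace ℝ H] :
    LocallyConvexSpace ℝ (WeakDual ℝ H) :=
  inferInstanceAs (LocallyConvexSpace ℝ (WeakBilin (topDualPairing ℝ H)))

theorem lcPi {ι V : Type*} [AddCommGroup V] [Module ℝ V] [TopologicalSpace V]
    [LocallyConvexSpace ℝ V] : LocallyConvexSpace ℝ (ι → V) := by
  refine LocallyConvexSpace.iInf (fun i => ?_)
  exact LocallyConvexSpace.induced (LinearMap.proj (R := ℝ) (φ := fun _ : ι => V) i)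

variable {X : Type*} [MeasurableSpace X] {μ : Measure X} [IsProbabilityMeasure μ]

noncomputable def J (f : Lp ℝ 2 μ) : WeakDual ℝ (Lp ℝ 2 μ) :=
  StrongDual.toWeakDual (InnerProductSpace.toDual ℝ (Lp ℝ 2 μ) f)

theorem J_apply (f g : Lp ℝ 2 μ) : J f g = inner ℝ f g := by
  simp [J]

theorem J_surj (φ : WeakDual ℝ (Lp ℝ 2 μ)) : ∃ f, J f = φ :=
  ⟨(InnerProductSpace.toDual ℝ (Lp ℝ 2 μ)).symm (WeakDual.toStrongDual φ), by simp [J]⟩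

theorem J_inj : Function.Injective (J (μ := μ)) := by
  intro f g h
  simpa [J] using h

theorem J_add (f g : Lp ℝ 2 μ) : J (f + g) = J f + J g := by simp [J]
theorem J_sub (f g : Lp ℝ 2 μ) : J (f - g) = J f - J g := by simp [J]
theorem J_sum {n : ℕ} (f : Fin n → Lp ℝ 2 μ) : J (∑ k, f k) = ∑ k, J (f k) := by simp [J]

theorem inner_eq (f g : Lp ℝ 2 μ) : inner ℝ f g = ∫ x, f x * g x ∂μ := by
  rw [L2.inner_def]
  congr 1; ext x; simp [mul_comm]

theorem inner_nonneg {f g : Lp ℝ 2 μ} (hf : 0 ≤ f) (hg : 0 ≤ g) : 0 ≤ inner ℝ f g := by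
  rw [inner_eq]
  apply integral_nonneg_of_ae
  filter_upwards [(Lp.coeFn_nonneg f).2 hf, (Lp.coeFn_nonneg g).2 hg] with x h1 h2
  exact mul_nonneg h1 h2

theorem nonneg_of_inner {f : Lp ℝ 2 μ} (h : ∀ g : Lp ℝ 2 μ, 0 ≤ g → 0 ≤ inner ℝ f g) : 0 ≤ f := by
  rw [← Lp.coeFn_nonneg]
  apply ae_nonneg_of_forall_setIntegral_nonneg
  · exact (Lp.memLp f).integrable (by norm_num)
  · intro s hs _
    rw [← L2.inner_indicatorConstLp_one hs (measure_ne_top μ s) f, real_inner_comm]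
    apply h
    rw [← Lp.coeFn_nonneg]
    filter_upwards [indicatorConstLp_coeFn (p := 2) (hs := hs) (hμs := measure_ne_top μ s) (c := (1:ℝ))] with x hx
    rw [hx]
    exact Set.indicator_nonneg (fun _ _ => zero_le_one) x

noncomputable def ind (s : Set X) (hs : MeasurableSet s) : Lp ℝ 2 μ :=
  indicatorConstLp 2 hs (measure_ne_top μ s) (1:ℝ)

theorem ind_ae (s : Set X) (hs : MeasurableSet s) :
    (ind s hs : Lp ℝ 2 μ) =ᵐ[μ] s.indicator (fun _ => (1:ℝ)) := indicatorConstLp_coeFn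

theorem ind_nonneg (s : Set X) (hs : MeasurableSet s) : 0 ≤ (ind s hs : Lp ℝ 2 μ) := by
  rw [← Lp.coeFn_nonneg]
  filter_upwards [ind_ae (μ := μ) s hs] with x hx
  rw [hx]
  exact Set.indicator_nonneg (fun _ _ => zero_le_one) x

theorem inner_ind (s : Set X) (hs : MeasurableSet s) (f : Lp ℝ 2 μ) :
    inner ℝ f (ind s hs) = ∫ x in s, f x ∂μ := by
  rw [real_inner_comm]; exact L2.inner_indicatorConstLp_one hs (measure_ne_top μ s) f

noncomputable def one : Lp ℝ 2 μ := ind Set.univ MeasurableSet.univ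

theorem one_ae : (one : Lp ℝ 2 μ) =ᵐ[μ] fun _ => (1:ℝ) := by
  filter_upwards [ind_ae (μ := μ) Set.univ MeasurableSet.univ] with x hx
  rw [one, hx]; simp

theorem inner_one (f : Lp ℝ 2 μ) : inner ℝ f one = ∫ x, f x ∂μ := by
  rw [one, inner_ind, setIntegral_univ]

theorem bdd_memLp {g : X → ℝ} (hg : Measurable g) (N : ℝ) (h0 : ∀ x, 0 ≤ g x) (h1 : ∀ x, g x ≤ N) :
    MemLp g 2 μ :=
  MemLp.of_bound hg.aestronglyMeasurable N (Filter.Eventually.of_forall fun x => by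
    rw [Real.norm_of_nonneg (h0 x)]; exact h1 x)

variable {n : ℕ}

def K (μ : Measure X) [IsProbabilityMeasure μ] (a : Fin n → ℝ) : Set (Fin n → WeakDual ℝ (Lp ℝ 2 μ)) :=
  {φ | (∀ k, ∀ g : Lp ℝ 2 μ, 0 ≤ g → 0 ≤ φ k g) ∧ (∑ k, φ k = J one) ∧ ∀ k, φ k one = a k}

theorem K_closed (a : Fin n → ℝ) : IsClosed (K μ a) := by
  have ev : ∀ k (g : Lp ℝ 2 μ), Continuous fun φ : Fin n → WeakDual ℝ (Lp ℝ 2 μ) => φ k g :=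
    fun k g => (WeakDual.eval_continuous g).comp (continuous_apply k)
  refine IsClosed.inter ?_ (IsClosed.inter ?_ ?_)
  · change IsClosed {φ : Fin n → WeakDual ℝ (Lp ℝ 2 μ) | ∀ k, ∀ g : Lp ℝ 2 μ, 0 ≤ g → 0 ≤ φ k g}
    simp only [Set.ofPred_forall]
    exact isClosed_iInter fun k => isClosed_iInter fun g => isClosed_iInter fun _ =>
      isClosed_le continuous_const (ev k g)
  · exact isClosed_eq (by fun_prop) continuous_const
  · change IsClosed {φ : Fin n → WeakDual ℝ (Lp ℝ 2 μ) | ∀ k, φ k one = a k}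
    simp only [Set.ofPred_forall]
    exact isClosed_iInter fun k => isClosed_eq (ev k one) continuous_const

theorem K_bound {a : Fin n → ℝ} {φ : Fin n → WeakDual ℝ (Lp ℝ 2 μ)} (h : φ ∈ K μ a) (k : Fin n)
    (g : Lp ℝ 2 μ) : ‖φ k g‖ ≤ ‖(one : Lp ℝ 2 μ)‖ * ‖g‖ := by
  obtain ⟨h1, h2, -⟩ := h
  have e1 := h1 k (|g| - g) (sub_nonneg.2 (le_abs_self g))
  have e2 := h1 k (|g| + g) (by
    have := neg_le_abs g
    exact neg_le_iff_add_nonneg.1 this)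
  rw [map_sub] at e1
  rw [map_add] at e2
  have e3 : φ k |g| ≤ ∑ j, φ j |g| :=
    Finset.single_le_sum (f := fun j => φ j |g|) (fun j _ => h1 j _ (abs_nonneg g)) (Finset.mem_univ k)
  have e4 : ∑ j, φ j |g| = J one |g| := by
    rw [← h2]
    let ev : WeakDual ℝ (Lp ℝ 2 μ) →+ ℝ :=
      { toFun := fun χ => χ |g|, map_zero' := rfl, map_add' := fun _ _ => rfl }
    exact (map_sum ev φ Finset.univ).symm
  rw [J_apply] at e4
  have e5 := real_inner_le_norm (one : Lp ℝ 2 μ) |g|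
  rw [norm_abs_eq_norm] at e5
  rw [Real.norm_eq_abs, abs_le]
  constructor <;> linarith

theorem K_compact (a : Fin n → ℝ) : IsCompact (K μ a) := by
  refine (isCompact_univ_pi (fun _ : Fin n =>
    WeakDual.isCompact_closedBall (0 : StrongDual ℝ (Lp ℝ 2 μ)) ‖(one : Lp ℝ 2 μ)‖)).of_isClosed_subset
    (K_closed a) ?_
  intro φ h k _
  simp only [Set.mem_preimage, mem_closedBall_zero_iff]
  exact ContinuousLinearMap.opNorm_le_bound _ (norm_nonneg _) (K_bound h k)

theorem K_nonempty (a : Fin n → ℝ) (ha : ∀ k, 0 ≤ a k) (hs : ∑ k, a k = 1) : (K μ a).Nonempty := by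
  refine ⟨fun k => J (a k • one), ?_, ?_, ?_⟩
  · intro k g hg
    rw [J_apply, inner_smul_left]
    exact mul_nonneg (ha k) (inner_nonneg (ind_nonneg _ _) hg)
  · rw [← J_sum, ← Finset.sum_smul, hs, one_smul]
  · intro k
    rw [J_apply, inner_smul_left, inner_one, integral_congr_ae one_ae]
    simp

/-- truncated costs -/
noncomputable def tr (d : X → Fin n → ℝ) (hd : ∀ k, Measurable fun x => d x k) (h0 : ∀ x k, 0 ≤ d x k)
    (N : ℕ) (k : Fin n) : Lp ℝ 2 μ :=
  (bdd_memLp (μ := μ) (g := fun x => min (d x k) N) ((hd k).min measurable_const) N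
    (fun x => le_min (h0 x k) N.cast_nonneg) (fun x => min_le_right _ _)).toLp

theorem tr_ae (d : X → Fin n → ℝ) (hd : ∀ k, Measurable fun x => d x k) (h0 : ∀ x k, 0 ≤ d x k)
    (N : ℕ) (k : Fin n) : (tr d hd h0 N k : Lp ℝ 2 μ) =ᵐ[μ] fun x => min (d x k) N :=
  MemLp.coeFn_toLp _

theorem tr_mono (d : X → Fin n → ℝ) (hd : ∀ k, Measurable fun x => d x k) (h0 : ∀ x k, 0 ≤ d x k)
    (k : Fin n) : Monotone fun N => (tr d hd h0 N k : Lp ℝ 2 μ) := by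
  intro N M h
  rw [← Lp.coeFn_le]
  filter_upwards [tr_ae (μ := μ) d hd h0 N k, tr_ae (μ := μ) d hd h0 M k] with x h1 h2
  rw [h1, h2]
  exact min_le_min_left _ (by exact_mod_cast h)

theorem tr_nonneg (d : X → Fin n → ℝ) (hd : ∀ k, Measurable fun x => d x k) (h0 : ∀ x k, 0 ≤ d x k)
    (N : ℕ) (k : Fin n) : 0 ≤ (tr d hd h0 N k : Lp ℝ 2 μ) := by
  rw [← Lp.coeFn_nonneg]
  filter_upwards [tr_ae (μ := μ) d hd h0 N k] with x h1
  rw [h1]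
  exact le_min (h0 x k) N.cast_nonneg

noncomputable def F (d : X → Fin n → ℝ) (hd : ∀ k, Measurable fun x => d x k) (h0 : ∀ x k, 0 ≤ d x k)
    (φ : Fin n → WeakDual ℝ (Lp ℝ 2 μ)) : ENNReal :=
  ⨆ N : ℕ, ENNReal.ofReal (∑ k, φ k (tr d hd h0 N k))

theorem F_lsc (d : X → Fin n → ℝ) (hd : ∀ k, Measurable fun x => d x k) (h0 : ∀ x k, 0 ≤ d x k) :
    LowerSemicontinuous (F (μ := μ) d hd h0) := by
  apply lowerSemicontinuous_iSup
  intro N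
  apply Continuous.lowerSemicontinuous
  apply ENNReal.continuous_ofReal.comp
  exact continuous_finsetSum _ fun k _ => (WeakDual.eval_continuous _).comp (continuous_apply k)

theorem F_add (d : X → Fin n → ℝ) (hd : ∀ k, Measurable fun x => d x k) (h0 : ∀ x k, 0 ≤ d x k)
    {a : Fin n → ℝ} {φ ψ : Fin n → WeakDual ℝ (Lp ℝ 2 μ)} (h1 : φ + ψ ∈ K μ a) (h2 : φ - ψ ∈ K μ a)  :
    F d hd h0 (φ + ψ) + F d hd h0 (φ - ψ) ≤ F d hd h0 φ + F d hd h0 φ := by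
  have mono : ∀ χ ∈ K μ a, Monotone fun N => ENNReal.ofReal (∑ k, χ k (tr d hd h0 N k)) := by
    intro χ hχ N M h
    apply ENNReal.ofReal_le_ofReal
    apply Finset.sum_le_sum
    intro k _
    have := hχ.1 k (tr d hd h0 M k - tr d hd h0 N k) (sub_nonneg.2 (tr_mono d hd h0 k h))
    rw [map_sub] at this
    linarith
  have nn : ∀ χ ∈ K μ a, ∀ N, 0 ≤ ∑ k, χ k (tr d hd h0 N k) := fun χ hχ N =>
    Finset.sum_nonneg fun k _ => hχ.1 k _ (tr_nonneg d hd h0 N k)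
  unfold F
  rw [ENNReal.iSup_add_iSup_of_monotone (mono _ h1) (mono _ h2)]
  apply iSup_le
  intro N
  rw [← ENNReal.ofReal_add (nn _ h1 N) (nn _ h2 N)]
  have : ∑ k, (φ + ψ) k (tr d hd h0 N k) + ∑ k, (φ - ψ) k (tr d hd h0 N k)
      = ∑ k, φ k (tr d hd h0 N k) + ∑ k, φ k (tr d hd h0 N k) := by
    rw [← Finset.sum_add_distrib, ← Finset.sum_add_distrib]
    apply Finset.sum_congr rfl
    intro k _
    have e1 : (φ + ψ) k (tr d hd h0 N k) = φ k (tr d hd h0 N k) + ψ k (tr d hd h0 N k) := rfl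
    have e2 : (φ - ψ) k (tr d hd h0 N k) = φ k (tr d hd h0 N k) - ψ k (tr d hd h0 N k) := rfl
    rw [e1, e2]; ring
  rw [this]
  refine ENNReal.ofReal_add_le.trans ?_
  exact add_le_add (le_iSup (fun N => ENNReal.ofReal (∑ k, φ k (tr d hd h0 N k))) N) (le_iSup (fun N => ENNReal.ofReal (∑ k, φ k (tr d hd h0 N k))) N)

theorem exists_ext (d : X → Fin n → ℝ) (hd : ∀ k, Measurable fun x => d x k) (h0 : ∀ x k, 0 ≤ d x k)
    (a : Fin n → ℝ) (ha : ∀ k, 0 ≤ a k) (hs : ∑ k, a k = 1) :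
    ∃ φ ∈ K μ a, (∀ χ ∈ K μ a, F d hd h0 φ ≤ F d hd h0 χ) ∧
      ∀ ψ, φ + ψ ∈ K μ a → φ - ψ ∈ K μ a → ψ = 0 := by
  obtain ⟨φ₀, hφ₀, hmin⟩ := LowerSemicontinuousOn.exists_isMinOn (K_nonempty (μ := μ) a ha hs) (K_compact a)
    ((F_lsc d hd h0).lowerSemicontinuousOn _)
  set m := F d hd h0 φ₀ with hm
  have : LocallyConvexSpace ℝ (Fin n → WeakDual ℝ (Lp ℝ 2 μ)) := lcPi
  have hMc : IsCompact (K μ a ∩ F d hd h0 ⁻¹' Set.Iic m) :=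
    (K_compact a).inter_right ((F_lsc d hd h0).isClosed_preimage m)
  obtain ⟨φ, hφ⟩ := hMc.extremePoints_nonempty ⟨φ₀, hφ₀, le_refl m⟩
  have hφ1 := hφ.1
  have hmin' : ∀ χ ∈ K μ a, m ≤ F d hd h0 χ := fun χ hχ => hmin hχ
  have aux : ∀ ψ, φ + ψ ∈ K μ a → φ - ψ ∈ K μ a → F d hd h0 (φ + ψ) ≤ m := by
    intro ψ h1 h2
    by_cases ht : m = ⊤
    · rw [ht]; exact le_top
    have h3 := (F_add d hd h0 h1 h2).trans (add_le_add hφ1.2 hφ1.2)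
    have h4 := (add_le_add (le_refl (F d hd h0 (φ + ψ))) (hmin' _ h2)).trans h3
    exact (ENNReal.add_le_add_iff_right ht).1 h4
  refine ⟨φ, hφ1.1, fun χ hχ => le_trans hφ1.2 (hmin' χ hχ), ?_⟩
  intro ψ h1 h2
  have m1 := aux ψ h1 h2
  have m2 := aux (-ψ) (by rwa [← sub_eq_add_neg]) (by rwa [sub_neg_eq_add])
  rw [← sub_eq_add_neg] at m2
  have := hφ.2 ⟨h1, m1⟩ ⟨h2, m2⟩ ⟨1/2, 1/2, by norm_num, by norm_num, by norm_num, by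
    rw [← smul_add]
    have : φ + ψ + (φ - ψ) = (2:ℝ) • φ := by rw [two_smul]; abel
    rw [this, smul_smul]; norm_num⟩
  simpa using this

theorem J_neg (f : Lp ℝ 2 μ) : J (-f) = -J f := by simp [J]

theorem perturb {a : Fin n → ℝ} {f : Fin n → Lp ℝ 2 μ} (hK : (fun k => J (f k)) ∈ K μ a)
    {i j : Fin n} (hij : i ≠ j) (v : Lp ℝ 2 μ) (h1 : 0 ≤ f i + v) (h2 : 0 ≤ f j - v)
    (h3 : inner ℝ v one = 0) :
    (fun k => J (f k)) + (Pi.single i (J v) - Pi.single j (J v)) ∈ K μ a := by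
  obtain ⟨k1, k2, k3⟩ := hK
  have e : (fun k => J (f k)) + (Pi.single i (J v) - Pi.single j (J v))
      = fun k => J (f k + ((Pi.single i v : Fin n → Lp ℝ 2 μ) k - (Pi.single j v : Fin n → Lp ℝ 2 μ) k)) := by
    have J0 : J (0 : Lp ℝ 2 μ) = 0 := by simp [J]
    funext k
    simp only [Pi.add_apply, Pi.sub_apply, J_add, J_sub]
    by_cases hki : k = i
    · subst hki; simp [hij, J0]
    · by_cases hkj : k = j
      · subst hkj; simp [hki, J0]
      · simp [hki, hkj, J0]
  rw [e]
  refine ⟨?_, ?_, ?_⟩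
  · intro k g hg
    by_cases hki : k = i
    · subst hki
      simp only [Pi.single_eq_same, Pi.single_eq_of_ne hij, sub_zero, J_apply]
      exact inner_nonneg h1 hg
    · by_cases hkj : k = j
      · subst hkj
        simp only [Pi.single_eq_same, Pi.single_eq_of_ne hki, zero_sub, J_apply]
        rw [← sub_eq_add_neg]
        exact inner_nonneg h2 hg
      · simp only [Pi.single_eq_of_ne hki, Pi.single_eq_of_ne hkj, sub_zero, add_zero]
        exact k1 k g hg
  · rw [← J_sum, Finset.sum_add_distrib, Finset.sum_sub_distrib, Finset.sum_pi_single', Finset.sum_pi_single']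
    simp only [Finset.mem_univ, if_true, sub_self, add_zero]
    rw [J_sum]; exact k2
  · intro k
    have := k3 k
    rw [J_apply] at this ⊢
    rw [inner_add_left, inner_sub_left, this]
    by_cases hki : k = i
    · subst hki
      simp [Pi.single_eq_of_ne hij, h3]
    · by_cases hkj : k = j
      · subst hkj
        simp [Pi.single_eq_of_ne hki, h3]
      · simp [Pi.single_eq_of_ne hki, Pi.single_eq_of_ne hkj]

theorem disj (hsplit : ∀ A : Set X, MeasurableSet A → μ A ≠ 0 →
      ∃ B ⊆ A, MeasurableSet B ∧ μ B ≠ 0 ∧ μ (A \ B) ≠ 0)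
    {a : Fin n → ℝ} {f : Fin n → Lp ℝ 2 μ} (hK : (fun k => J (f k)) ∈ K μ a)
    (hext : ∀ ψ, (fun k => J (f k)) + ψ ∈ K μ a → (fun k => J (f k)) - ψ ∈ K μ a → ψ = 0)
    (hf : ∀ k, 0 ≤ f k)
    {i j : Fin n} (hij : i ≠ j) : μ {x | 0 < f i x ∧ 0 < f j x} = 0 := by
  by_contra hne
  have hun : {x | 0 < f i x ∧ 0 < f j x} =
      ⋃ m : ℕ, {x | 1 / ((m:ℝ) + 1) < f i x ∧ 1 / ((m:ℝ) + 1) < f j x} := by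
    ext x
    simp only [Set.mem_ofPred_eq, Set.mem_iUnion]
    constructor
    · rintro ⟨h1, h2⟩
      obtain ⟨m, hm⟩ := exists_nat_one_div_lt (lt_min h1 h2)
      exact ⟨m, lt_min_iff.1 hm⟩
    · rintro ⟨m, h1, h2⟩
      have : (0:ℝ) < 1 / ((m:ℝ) + 1) := by positivity
      exact ⟨this.trans h1, this.trans h2⟩
  rw [hun] at hne
  have : ∃ m : ℕ, μ {x | 1 / ((m:ℝ) + 1) < f i x ∧ 1 / ((m:ℝ) + 1) < f j x} ≠ 0 := by
    by_contra! hh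
    exact hne (measure_iUnion_null hh)
  obtain ⟨m, hm⟩ := this
  have he : (0:ℝ) < 1 / ((m:ℝ) + 1) := by positivity
  set ε : ℝ := 1 / ((m:ℝ) + 1)
  have hmf : ∀ k, Measurable (f k) := fun k => (Lp.stronglyMeasurable (f k)).measurable
  have hA : MeasurableSet {x | ε < f i x ∧ ε < f j x} :=
    (measurableSet_lt measurable_const (hmf i)).inter (measurableSet_lt measurable_const (hmf j))
  obtain ⟨B, hBA, hB, hB0, hC0⟩ := hsplit _ hA hm
  have hC := hA.diff hB
  set C := {x | ε < f i x ∧ ε < f j x} \ B with hCdef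
  have hb : 0 < μ.real B := ENNReal.toReal_pos hB0 (measure_ne_top _ _)
  have hc : 0 < μ.real C := ENNReal.toReal_pos hC0 (measure_ne_top _ _)
  have hb1 : μ.real B ≤ 1 := measureReal_le_one
  have hc1 : μ.real C ≤ 1 := measureReal_le_one
  let u : Lp ℝ 2 μ := (ε * μ.real C) • ind B hB - (ε * μ.real B) • ind C hC
  have hu : u =ᵐ[μ] fun x => (ε * μ.real C) * B.indicator (fun _ => (1:ℝ)) x
      - (ε * μ.real B) * C.indicator (fun _ => (1:ℝ)) x := by
    filter_upwards [Lp.coeFn_sub ((ε * μ.real C) • ind B hB : Lp ℝ 2 μ) ((ε * μ.real B) • ind C hC),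
      Lp.coeFn_smul (ε * μ.real C) (ind B hB : Lp ℝ 2 μ), Lp.coeFn_smul (ε * μ.real B) (ind C hC : Lp ℝ 2 μ),
      ind_ae (μ := μ) B hB, ind_ae (μ := μ) C hC] with x h1 h2 h3 h4 h5
    rw [h1, Pi.sub_apply, h2, h3, Pi.smul_apply, Pi.smul_apply, h4, h5, smul_eq_mul, smul_eq_mul]
  have hbound : ∀ᵐ x ∂μ, |u x| ≤ f i x ∧ |u x| ≤ f j x := by
    filter_upwards [hu, (Lp.coeFn_nonneg _).2 (hf i), (Lp.coeFn_nonneg _).2 (hf j)] with x hx p1 p2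
    rw [hx]
    by_cases xB : x ∈ B
    · have xC : x ∉ C := fun h => h.2 xB
      have := hBA xB
      simp only [Set.indicator_of_mem xB, Set.indicator_of_notMem xC, mul_one, mul_zero, sub_zero]
      rw [abs_of_nonneg (by positivity)]
      have : ε * μ.real C ≤ ε := mul_le_of_le_one_right he.le hc1
      constructor <;> linarith [(hBA xB).1, (hBA xB).2]
    · by_cases xC : x ∈ C
      · simp only [Set.indicator_of_mem xC, Set.indicator_of_notMem xB, mul_one, mul_zero, zero_sub, abs_neg]
        rw [abs_of_nonneg (by positivity)]
        have : ε * μ.real B ≤ ε := mul_le_of_le_one_right he.le hb1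
        constructor <;> linarith [xC.1.1, xC.1.2]
      · simp only [Set.indicator_of_notMem xC, Set.indicator_of_notMem xB, mul_zero, sub_zero, abs_zero]
        exact ⟨p1, p2⟩
  have pp : ∀ k, (∀ᵐ x ∂μ, |u x| ≤ f k x) → 0 ≤ f k + u ∧ 0 ≤ f k - u := by
    intro k hk
    constructor
    · rw [← Lp.coeFn_nonneg]
      filter_upwards [hk, Lp.coeFn_add (f k) u] with x h1 h2
      rw [h2]
      have := neg_abs_le (u x)
      simp only [Pi.zero_apply, Pi.add_apply]; linarith
    · rw [← Lp.coeFn_nonneg]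
      filter_upwards [hk, Lp.coeFn_sub (f k) u] with x h1 h2
      rw [h2]
      have := le_abs_self (u x)
      simp only [Pi.zero_apply, Pi.sub_apply]; linarith
  have ii : ∀ (s : Set X) (hs : MeasurableSet s), inner ℝ (ind s hs : Lp ℝ 2 μ) one = μ.real s := by
    intro s hs
    rw [inner_one, integral_congr_ae (ind_ae s hs), integral_indicator hs]
    simp
  have h3 : inner ℝ u one = 0 := by
    simp only [u]
    rw [inner_sub_left, inner_smul_left, inner_smul_left, ii, ii]
    simp; ring
  obtain ⟨i1, i2⟩ := pp i (hbound.mono fun x h => h.1)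
  obtain ⟨j1, j2⟩ := pp j (hbound.mono fun x h => h.2)
  have q1 := perturb hK hij u i1 j2 h3
  have q2 := perturb hK hij (-u) (by rwa [← sub_eq_add_neg]) (by rwa [sub_neg_eq_add])
    (by rw [inner_neg_left, h3, neg_zero])
  have hψ := hext _ q1 (by
    convert q2 using 1
    rw [J_neg, Pi.single_neg, Pi.single_neg]; abel)
  have hi := congrFun hψ i
  simp only [Pi.sub_apply, Pi.single_eq_same, Pi.single_eq_of_ne hij, sub_zero, Pi.zero_apply] at hi
  have u0 : u = 0 := J_inj (by rw [hi]; simp [J])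
  apply hB0
  have : ∀ᵐ x ∂μ, x ∉ B := by
    have z := Lp.coeFn_zero ℝ 2 μ
    rw [← u0] at z
    filter_upwards [z, hu] with x h1 h2 xB
    have xC : x ∉ C := fun h => h.2 xB
    rw [h1] at h2
    simp only [Set.indicator_of_mem xB, Set.indicator_of_notMem xC, mul_one, mul_zero, sub_zero, Pi.zero_apply] at h2
    have : 0 < ε * μ.real C := by positivity
    linarith
  simpa [ae_iff] using this

theorem exists_T (hn : 0 < n) {f : Fin n → Lp ℝ 2 μ} (hf : ∀ k, 0 ≤ f k) (hsum : ∑ k, f k = one)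
    (hd : ∀ i j, i ≠ j → μ {x | 0 < f i x ∧ 0 < f j x} = 0) :
    ∃ (T : X → Fin n) (hT : Measurable T), ∀ k, f k = ind (T ⁻¹' {k}) (hT (measurableSet_singleton k)) := by
  have hmf : ∀ k, Measurable (f k) := fun k => (Lp.stronglyMeasurable (f k)).measurable
  have : Nonempty (Fin n) := ⟨⟨0, hn⟩⟩
  have hD : ∀ k, MeasurableSet {x | 0 < f k x} := fun k => measurableSet_lt measurable_const (hmf k)
  obtain ⟨T, hT, hTe⟩ := exists_measurable_piecewise
    (fun k : Fin n => {x | 0 < f k x} \ ⋃ j ∈ {j | j ≠ k}, {x | 0 < f j x})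
    (fun k => (hD k).diff (MeasurableSet.biUnion (Set.to_countable _) fun j _ => hD j))
    (fun k _ => k) (fun k => measurable_const) (by
      intro i j hij x hx
      exfalso
      apply hx.1.2
      simp only [Set.mem_iUnion]
      exact ⟨j, hij.symm, hx.2.1⟩)
  refine ⟨T, hT, fun k => ?_⟩
  apply Lp.ext
  have hd' : ∀ᵐ x ∂μ, ∀ i j, i ≠ j → ¬ (0 < f i x ∧ 0 < f j x) := by
    rw [ae_all_iff]; intro i
    rw [ae_all_iff]; intro j
    by_cases h : i = j
    · simp [h]
    · have := hd i j h
      have h2 : ∀ᵐ x ∂μ, ¬ (0 < f i x ∧ 0 < f j x) := by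
        rw [ae_iff]; simpa only [not_not] using this
      exact h2.mono fun x hx _ => hx
  have hnn : ∀ᵐ x ∂μ, ∀ k, 0 ≤ f k x := by
    rw [ae_all_iff]; intro k; exact (Lp.coeFn_nonneg _).2 (hf k)
  have hs1 : ∀ᵐ x ∂μ, ∑ k, f k x = 1 := by
    have := Lp.coeFn_finsetSum (p := 2) (μ := μ) Finset.univ f
    rw [hsum] at this
    filter_upwards [this, one_ae (μ := μ)] with x h1 h2
    rw [h1] at h2
    simpa using h2
  filter_upwards [hd', hnn, hs1, ind_ae (μ := μ) (T ⁻¹' {k}) (hT (measurableSet_singleton k))] with x x1 x2 x3 x4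
  rw [x4]
  have : ∃ i, 0 < f i x := by
    by_contra! h
    have : ∑ k, f k x ≤ 0 := Finset.sum_nonpos fun i _ => h i
    linarith
  obtain ⟨i, hi⟩ := this
  have hz : ∀ j, j ≠ i → f j x = 0 := by
    intro j hj
    by_contra h
    exact x1 j i hj ⟨lt_of_le_of_ne (x2 j) (Ne.symm h), hi⟩
  have hTx : T x = i := by
    apply hTe i
    refine ⟨hi, ?_⟩
    simp only [Set.mem_iUnion, not_exists]
    intro j hj hjx
    exact x1 j i hj ⟨hjx, hi⟩
  have hfi : f i x = 1 := by
    rw [← x3, Finset.sum_eq_single i (fun j _ hj => hz j hj) (by simp)]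
  by_cases hk : k = i
  · subst hk
    rw [Set.indicator_of_mem (by simpa using hTx), hfi]
  · rw [Set.indicator_of_notMem (by simp [hTx]; exact fun h => hk h.symm), hz k hk]

theorem sum_ind (T : X → Fin n) (g : X → Fin n → ℝ) (x : X) :
    ∑ k, (T ⁻¹' {k}).indicator (fun x => g x k) x = g x (T x) := by
  rw [Finset.sum_eq_single (T x)]
  · exact Set.indicator_of_mem (s := T ⁻¹' {T x}) rfl _
  · intro j _ hj
    exact Set.indicator_of_notMem (s := T ⁻¹' {j}) (fun h => hj (Set.mem_singleton_iff.1 h).symm) _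
  · simp

theorem ind_mem_K {a : Fin n → ℝ} (ha : ∀ k, 0 ≤ a k) (T : X → Fin n) (hT : Measurable T)
    (hm : ∀ k, μ (T ⁻¹' {k}) = ENNReal.ofReal (a k)) :
    (fun k => J (ind (T ⁻¹' {k}) (hT (measurableSet_singleton k)))) ∈ K μ a := by
  refine ⟨?_, ?_, ?_⟩
  · intro k g hg
    rw [J_apply]
    exact inner_nonneg (ind_nonneg _ _) hg
  · rw [← J_sum]
    congr 1
    apply Lp.ext
    have h : ∀ᵐ x ∂μ, ∀ k, (ind (T ⁻¹' {k}) (hT (measurableSet_singleton k)) : Lp ℝ 2 μ) x =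
      (T ⁻¹' {k}).indicator (fun _ => (1:ℝ)) x := by
      rw [ae_all_iff]; exact fun k => ind_ae _ _
    filter_upwards [h, one_ae (μ := μ), Lp.coeFn_finsetSum (p := 2) (μ := μ) Finset.univ
      (fun k => (ind (T ⁻¹' {k}) (hT (measurableSet_singleton k)) : Lp ℝ 2 μ))] with x h1 h2 h3
    rw [h2, h3]
    rw [Finset.sum_apply, Finset.sum_congr rfl (fun k _ => h1 k)]
    exact sum_ind T (fun _ _ => 1) x
  · intro k
    rw [J_apply, inner_one, integral_congr_ae (ind_ae _ _), integral_indicator (hT (measurableSet_singleton k))]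
    simp [Measure.real, hm, ha k]

theorem F_ind (d : X → Fin n → ℝ) (hd : ∀ k, Measurable fun x => d x k) (h0 : ∀ x k, 0 ≤ d x k)
    (T : X → Fin n) (hT : Measurable T) :
    F (μ := μ) d hd h0 (fun k => J (ind (T ⁻¹' {k}) (hT (measurableSet_singleton k)))) =
      ∫⁻ x, ENNReal.ofReal (d x (T x)) ∂μ := by
  have hdT : Measurable fun x => d x (T x) := by
    have : Measurable fun p : X × Fin n => d p.1 p.2 := measurable_from_prod_countable_left hd
    exact this.comp (measurable_id.prodMk hT)
  have key : ∀ N : ℕ, ENNReal.ofReal (∑ k, J (ind (T ⁻¹' {k}) (hT (measurableSet_singleton k)))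
      (tr d hd h0 N k : Lp ℝ 2 μ)) = ∫⁻ x, ENNReal.ofReal (min (d x (T x)) N) ∂μ := by
    intro N
    have hint : ∀ k, Integrable (fun x => min (d x k) (N:ℝ)) μ := fun k =>
      (bdd_memLp (μ := μ) (g := fun x => min (d x k) N) ((hd k).min measurable_const) N
        (fun x => le_min (h0 x k) N.cast_nonneg) (fun x => min_le_right _ _)).integrable (by norm_num)
    have e1 : ∀ k, J (ind (T ⁻¹' {k}) (hT (measurableSet_singleton k))) (tr d hd h0 N k : Lp ℝ 2 μ)
        = ∫ x, (T ⁻¹' {k}).indicator (fun x => min (d x k) (N:ℝ)) x ∂μ := by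
      intro k
      rw [J_apply, real_inner_comm, inner_ind, integral_indicator (hT (measurableSet_singleton k))]
      exact integral_congr_ae (ae_restrict_of_ae (tr_ae d hd h0 N k))
    simp only [e1]
    rw [← integral_finsetSum _ (fun k _ => (hint k).indicator (hT (measurableSet_singleton k)))]
    have e2 : ∀ x, ∑ k, (T ⁻¹' {k}).indicator (fun x => min (d x k) (N:ℝ)) x = min (d x (T x)) N := by
      intro x
      exact sum_ind T (fun x k => min (d x k) (N:ℝ)) x
    simp only [e2]
    rw [ofReal_integral_eq_lintegral_ofReal]
    · exact (bdd_memLp (μ := μ) (g := fun x => min (d x (T x)) N) (hdT.min measurable_const) N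
        (fun x => le_min (h0 x _) N.cast_nonneg) (fun x => min_le_right _ _)).integrable (by norm_num)
    · exact Filter.Eventually.of_forall fun x => le_min (h0 x _) N.cast_nonneg
  unfold F
  simp only [key]
  rw [← lintegral_iSup]
  · congr 1
    ext x
    apply le_antisymm
    · exact iSup_le fun N => ENNReal.ofReal_le_ofReal (min_le_left _ _)
    · obtain ⟨N, hN⟩ := exists_nat_ge (d x (T x))
      refine le_trans ?_ (le_iSup _ N)
      rw [min_eq_left hN]
  · intro N
    exact (hdT.min measurable_const).ennreal_ofReal
  · intro N M h x
    exact ENNReal.ofReal_le_ofReal (min_le_min_left _ (by exact_mod_cast h))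

theorem main_nonneg (hsplit : ∀ A : Set X, MeasurableSet A → μ A ≠ 0 →
      ∃ B ⊆ A, MeasurableSet B ∧ μ B ≠ 0 ∧ μ (A \ B) ≠ 0) (hn : 0 < n)
    (d : X → Fin n → ℝ) (hd : ∀ k, Measurable fun x => d x k) (h0 : ∀ x k, 0 ≤ d x k)
    (a : Fin n → ℝ) (ha : ∀ k, 0 ≤ a k) (hs : ∑ k, a k = 1) :
    ∃ T : X → Fin n, Measurable T ∧ (∀ k, μ (T ⁻¹' {k}) = ENNReal.ofReal (a k)) ∧
      ∀ T' : X → Fin n, Measurable T' → (∀ k, μ (T' ⁻¹' {k}) = ENNReal.ofReal (a k)) →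
        ∫⁻ x, ENNReal.ofReal (d x (T x)) ∂μ ≤ ∫⁻ x, ENNReal.ofReal (d x (T' x)) ∂μ := by
  obtain ⟨φ, hK, hmin, hext⟩ := exists_ext (μ := μ) d hd h0 a ha hs
  choose f hf using fun k => J_surj (φ k)
  obtain rfl : (fun k => J (f k)) = φ := funext hf
  have hnn : ∀ k, 0 ≤ f k := fun k => nonneg_of_inner fun g hg => by
    have := hK.1 k g hg
    rwa [J_apply] at this
  have hsum : ∑ k, f k = one := J_inj (by rw [J_sum]; exact hK.2.1)
  obtain ⟨T, hT, hfT⟩ := exists_T hn hnn hsum (fun i j hij => disj hsplit hK hext hnn hij)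
  have hφ : (fun k => J (f k)) = fun k => J (ind (T ⁻¹' {k}) (hT (measurableSet_singleton k))) := by
    funext k; rw [← hfT k]
  refine ⟨T, hT, ?_, ?_⟩
  · intro k
    have := hK.2.2 k
    rw [J_apply, inner_one, hfT k, integral_congr_ae (ind_ae _ _), integral_indicator (hT (measurableSet_singleton k))] at this
    simp only [integral_const, MeasurableSet.univ, measureReal_restrict_apply, Set.univ_inter, smul_eq_mul, mul_one] at this
    rw [← this, Measure.real, ENNReal.ofReal_toReal (measure_ne_top _ _)]
  · intro T' hT' hm
    rw [← F_ind d hd h0 T hT, ← F_ind d hd h0 T' hT', ← hφ]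
    exact hmin _ (ind_mem_K ha T' hT' hm)

theorem split_of_noAtoms {X : Type*} [MetricSpace X] [SecondCountableTopology X] [MeasurableSpace X] [BorelSpace X]
    (μ : Measure X) [IsProbabilityMeasure μ] [NullSingletonClass μ] (A : Set X) (hA : MeasurableSet A) (h : μ A ≠ 0) :
    ∃ B ⊆ A, MeasurableSet B ∧ μ B ≠ 0 ∧ μ (A \ B) ≠ 0 := by
  obtain ⟨x, hxA, hx⟩ := exists_mem_forall_mem_nhdsWithin_pos_measure h
  by_contra! hcon
  have full : ∀ m : ℕ, μ (A \ (A ∩ Metric.ball x (1 / ((m:ℝ) + 1)))) = 0 := by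
    intro m
    apply hcon _ Set.inter_subset_left (hA.inter measurableSet_ball)
    refine (hx _ ?_).ne'
    exact inter_mem_nhdsWithin A (Metric.ball_mem_nhds x (by positivity))
  have : A ⊆ {x} ∪ ⋃ m : ℕ, (A \ (A ∩ Metric.ball x (1 / ((m:ℝ) + 1)))) := by
    intro y hy
    by_cases hyx : y = x
    · left; exact hyx
    · right
      obtain ⟨m, hm⟩ := exists_nat_one_div_lt (dist_pos.2 hyx)
      rw [Set.mem_iUnion]
      exact ⟨m, hy, fun hh => by have := Metric.mem_ball.1 hh.2; linarith⟩
  apply h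
  refine measure_mono_null this (measure_union_null (measure_singleton x) (measure_iUnion_null full))

end SDOT

theorem semidiscrete_optimal_transport_exists
    (Ω : Set (EuclideanSpace ℝ (Fin 2))) (hΩ : IsCompact Ω)
    (μ : Measure (EuclideanSpace ℝ (Fin 2))) [IsProbabilityMeasure μ]
    (hac : μ ≪ volume) (hconc : μ Ωᶜ = 0)
    (n : ℕ) (hn : 0 < n)
    (s : Fin n → EuclideanSpace ℝ (Fin 2)) (hs : Function.Injective s)
    (a : Fin n → ℝ) (ha : ∀ k, 0 ≤ a k) (hsum : ∑ k, a k = 1)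
    (c : EuclideanSpace ℝ (Fin 2) → Fin n → ℝ)
    (hc : ∀ k, LowerSemicontinuousOn (fun x => c x k) Ω)
    (hcb : ∀ k, ∃ C : ℝ, ∀ x ∈ Ω, C ≤ c x k) :
    ∃ T : EuclideanSpace ℝ (Fin 2) → Fin n, Measurable T ∧
      (∀ k, μ (T ⁻¹' {k}) = ENNReal.ofReal (a k)) ∧
      ∀ T' : EuclideanSpace ℝ (Fin 2) → Fin n, Measurable T' →
        (∀ k, μ (T' ⁻¹' {k}) = ENNReal.ofReal (a k)) →
        (∫ x, c x (T x) ∂μ) ≤ ∫ x, c x (T' x) ∂μ := by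
  classical
  have : NullSingletonClass μ := ⟨fun x => hac (measure_singleton x)⟩
  have : Nonempty (Fin n) := ⟨⟨0, hn⟩⟩
  choose C0 hC0 using hcb
  obtain ⟨C, hC⟩ : ∃ C : ℝ, ∀ k, C ≤ C0 k := by
    obtain ⟨k, hk⟩ := Finite.exists_min C0
    exact ⟨C0 k, hk⟩
  let d : EuclideanSpace ℝ (Fin 2) → Fin n → ℝ := fun x k => Ω.indicator (fun x => c x k - C) x
  have hmΩ := hΩ.isClosed.measurableSet
  have h0 : ∀ x k, 0 ≤ d x k := fun x k =>
    Set.indicator_nonneg (fun y hy => by linarith [hC0 k y hy, hC k]) x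
  have hd : ∀ k, Measurable fun x => d x k := by
    intro k
    have hr : Measurable (Ω.domRestrict fun x => c x k) :=
      (lowerSemicontinuous_restrict_iff.2 (hc k)).measurable
    refine measurable_of_restrict_of_restrict_compl hmΩ ?_ ?_
    · convert hr.sub_const C using 1
      ext x
      simp [d]
    · convert measurable_const (a := (0:ℝ)) using 1
      ext x
      exact Set.indicator_of_notMem x.2 (fun x => c x k - C)
  have hdT : ∀ T : EuclideanSpace ℝ (Fin 2) → Fin n, Measurable T → Measurable fun x => d x (T x) := by
    intro T hT
    have : Measurable fun p : EuclideanSpace ℝ (Fin 2) × Fin n => d p.1 p.2 :=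
      measurable_from_prod_countable_left hd
    exact this.comp (measurable_id.prodMk hT)
  have hae : ∀ T : EuclideanSpace ℝ (Fin 2) → Fin n,
      (fun x => c x (T x)) =ᵐ[μ] fun x => d x (T x) + C := by
    intro T
    have : ∀ᵐ x ∂μ, x ∈ Ω := by rw [ae_iff]; exact hconc
    filter_upwards [this] with x hx
    simp only [d, Set.indicator_of_mem hx]; ring
  obtain ⟨T, hT, hTm, hopt⟩ := SDOT.main_nonneg (SDOT.split_of_noAtoms μ) hn d hd h0 a ha hsum
  have key : ∀ T' : EuclideanSpace ℝ (Fin 2) → Fin n, Measurable T' →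
      (∀ k, μ (T' ⁻¹' {k}) = ENNReal.ofReal (a k)) → Integrable (fun x => c x (T' x)) μ →
      (∫ x, c x (T x) ∂μ) ≤ ∫ x, c x (T' x) ∂μ := by
    intro T' hT' hm hi
    have hle := hopt T' hT' hm
    have hi' : Integrable (fun x => d x (T' x)) μ := by
      have h := (hi.congr (hae T')).sub (integrable_const C)
      refine h.congr (Filter.Eventually.of_forall fun x => ?_)
      simp
    have e' := ofReal_integral_eq_lintegral_ofReal hi' (Filter.Eventually.of_forall fun x => h0 x _)
    have hiT : Integrable (fun x => d x (T x)) μ := by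
      refine ⟨(hdT T hT).aestronglyMeasurable, ?_⟩
      rw [hasFiniteIntegral_iff_ofReal (Filter.Eventually.of_forall fun x => h0 x _)]
      refine hle.trans_lt ?_
      rw [← e']; exact ENNReal.ofReal_lt_top
    have e := ofReal_integral_eq_lintegral_ofReal hiT (Filter.Eventually.of_forall fun x => h0 x _)
    rw [← e, ← e', ENNReal.ofReal_le_ofReal_iff (integral_nonneg fun x => h0 x _)] at hle
    rw [integral_congr_ae (hae T), integral_congr_ae (hae T'), integral_add hiT (integrable_const C),
      integral_add hi' (integrable_const C)]
    linarith
  by_cases hbad : (0 < ∫ x, c x (T x) ∂μ) ∧ ∃ T0 : EuclideanSpace ℝ (Fin 2) → Fin n, Measurable T0 ∧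
      (∀ k, μ (T0 ⁻¹' {k}) = ENNReal.ofReal (a k)) ∧ ¬ Integrable (fun x => c x (T0 x)) μ
  · obtain ⟨hpos, T0, h1, h2, h3⟩ := hbad
    refine ⟨T0, h1, h2, fun T' hT' hm => ?_⟩
    rw [integral_undef h3]
    by_cases hi : Integrable (fun x => c x (T' x)) μ
    · exact hpos.le.trans (key T' hT' hm hi)
    · rw [integral_undef hi]
  · refine ⟨T, hT, hTm, fun T' hT' hm => ?_⟩
    by_cases hi : Integrable (fun x => c x (T' x)) μ
    · exact key T' hT' hm hi
    · rw [integral_undef hi]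
      by_contra hneg
      exact hbad ⟨not_le.1 hneg, T', hT', hm, hi⟩
end
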